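/- arXiv:0906.5402 — 2 statements merged into one kernel-verified Lean document; each statement's English description precedes it below -/
import Mathlib

section
/- (Theorem 2, boundedness on H^1.) Let α = (α_n)_{n≥0} be a monotone decreasing sequence of positive real numbers with nondecreasing successive differences (α_n − 2α_{n+1} + α_{n+2} ≥ 0 for all n), and suppose ‖α‖ := ∑_{n≥0} α_n/(n+1) < ∞. Then for every f ∈ H^∞, the Toeplitz operator T_{f*α} is bounded on H^1: for every h ∈ H^1 with boundary function h* ∈ L^1(𝕋), ‖T_{f*α} h‖_{H^1} ≤ 12 ‖f‖_{H^∞} ‖α‖ ‖h‖_{H^1}. -/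
open MeasureTheory Complex Metric Set
open scoped ENNReal

/-- Normalized Lebesgue (arc-length) measure on the unit circle `𝕋 ⊆ ℂ`. -/
noncomputable def circleMeasure : Measure ℂ :=
  Measure.map (fun θ : ℝ => Complex.exp (θ * Complex.I))
    ((ENNReal.ofReal (2 * Real.pi))⁻¹ • volume.restrict (Set.Ioc 0 (2 * Real.pi)))

/-- `‖f‖_{H^p}^p = sup_{0<r<1} ∫_𝕋 |f(rζ)|^p dm(ζ)`, as a value in `[0,∞]`. -/
noncomputable def hardyNorm (p : ℝ) (f : ℂ → ℂ) : ℝ≥0∞ :=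
  ⨆ r ∈ Set.Ioo (0 : ℝ) 1,
    ∫⁻ ζ, ENNReal.ofReal (‖f (↑r * ζ)‖ ^ p) ∂circleMeasure

/-- `‖f‖_{H^∞} = sup_{z ∈ 𝔻} |f(z)|`, as a value in `[0,∞]`. -/
noncomputable def eSupAbs (f : ℂ → ℂ) : ℝ≥0∞ :=
  ⨆ z ∈ Metric.ball (0 : ℂ) 1, ENNReal.ofReal ‖f z‖

/-- `g` is the boundary function of `f` : radial limits a.e. on `𝕋`. -/
def IsBoundaryFn (f g : ℂ → ℂ) : Prop :=
  ∀ᵐ ζ ∂circleMeasure,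
    Filter.Tendsto (fun r : ℝ => f (↑r * ζ)) (nhdsWithin 1 (Set.Iio 1)) (nhds (g ζ))

/-- `Λ(f) = ess sup_{η ∈ 𝕋} ∫_𝕋 |f*(ζ) - f*(η)|/|ζ - η| dm(ζ)` for a boundary function `f*`. -/
noncomputable def Lam (g : ℂ → ℂ) : ℝ≥0∞ :=
  essSup (fun η =>
    ∫⁻ ζ, ENNReal.ofReal (‖g ζ - g η‖ / ‖ζ - η‖) ∂circleMeasure)
    circleMeasure

/-- Toeplitz operator: `(T_g h)(z) = ∫_𝕋 conj(g*(ζ)) h*(ζ)/(1 - conj(ζ) z) dm(ζ)`,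
given boundary functions `gs = g*`, `hs = h*`. -/
noncomputable def toeplitz (gs hs : ℂ → ℂ) : ℂ → ℂ := fun z =>
  ∫ ζ, (starRingEnd ℂ) (gs ζ) * hs ζ / (1 - (starRingEnd ℂ) ζ * z) ∂circleMeasure

/-- `f̂(n)`, the `n`-th Taylor coefficient of `f` at `0`. -/
noncomputable def taylorCoeff (f : ℂ → ℂ) (n : ℕ) : ℂ :=
  iteratedDeriv n f 0 / n.factorial

/-- `(f*α)(z) = ∑_{n≥0} f̂(n) α_n z^n`. -/
noncomputable def seqConv (f : ℂ → ℂ) (α : ℕ → ℝ) : ℂ → ℂ := fun z =>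
  ∑' n : ℕ, taylorCoeff f n * (α n : ℂ) * z ^ n

/-- Partial sum `S_n(f)(z) = ∑_{k=0}^n f̂(k) z^k`. -/
noncomputable def taylorPartial (f : ℂ → ℂ) (n : ℕ) (z : ℂ) : ℂ :=
  ∑ k ∈ Finset.range (n + 1), taylorCoeff f k * z ^ k

/-- Cesàro mean `σ_n(f)(z) = (1/(n+1)) ∑_{k=0}^n S_k(f)(z)`. -/
noncomputable def cesaro (f : ℂ → ℂ) (n : ℕ) (z : ℂ) : ℂ :=
  ((n : ℂ) + 1)⁻¹ * ∑ k ∈ Finset.range (n + 1), taylorPartial f k z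


/-! ### Basic facts on the circle measure -/

namespace HardyAux
open Filter Topology

lemma measurable_expI : Measurable (fun θ : ℝ => Complex.exp (θ * Complex.I)) := by fun_prop

instance : IsProbabilityMeasure circleMeasure := by
  unfold circleMeasure
  have : IsProbabilityMeasure
      ((ENNReal.ofReal (2 * Real.pi))⁻¹ • volume.restrict (Set.Ioc 0 (2 * Real.pi))) := by
    constructor
    simp only [Measure.smul_apply, MeasurableSet.univ, Measure.restrict_apply, univ_inter,
      Real.volume_Ioc, sub_zero, smul_eq_mul]
    exact ENNReal.inv_mul_cancel (by simp [Real.pi_pos]) ENNReal.ofReal_ne_top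
  exact Measure.isProbabilityMeasure_map measurable_expI.aemeasurable

lemma ae_norm : ∀ᵐ ζ ∂circleMeasure, ‖ζ‖ = 1 := by
  unfold circleMeasure
  rw [ae_map_iff measurable_expI.aemeasurable (measurableSet_eq_fun (by fun_prop) (by fun_prop))]
  exact Filter.Eventually.of_forall fun θ => Complex.norm_exp_ofReal_mul_I θ

/-- a function continuous on the unit circle is a.e. strongly measurable -/
lemma integral_pow (n : ℕ) : ∫ ζ, ζ ^ n ∂circleMeasure = if n = 0 then 1 else 0 := by
  split_ifs with h
  · subst h; simp
  · unfold circleMeasure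
    rw [integral_map measurable_expI.aemeasurable (by fun_prop), integral_smul_measure,
      ← intervalIntegral.integral_of_le (by positivity)]
    have h1 : ∀ θ : ℝ, Complex.exp (θ * Complex.I) ^ n
        = Complex.exp ((n * Complex.I) * θ) := by
      intro θ; rw [← Complex.exp_nat_mul]; ring_nf
    simp_rw [h1]
    rw [integral_exp_mul_complex (by simp [h])]
    have : Complex.exp (n * Complex.I * ((2 * Real.pi : ℝ) : ℂ)) = 1 := by
      rw [Complex.exp_eq_one_iff]; exact ⟨n, by push_cast; ring⟩
    rw [this]; simp

lemma pow_mul_conj_pow {ζ : ℂ} (hζ : ‖ζ‖ = 1) (m k : ℕ) :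
    ζ ^ (m + k) * (starRingEnd ℂ ζ) ^ m = ζ ^ k := by
  have : ζ * starRingEnd ℂ ζ = 1 := by rw [Complex.mul_conj']; simp [hζ]
  rw [pow_add, mul_right_comm, ← mul_pow, this]; simp

lemma integral_pow_conj (n m : ℕ) :
    ∫ ζ, ζ ^ n * (starRingEnd ℂ ζ) ^ m ∂circleMeasure = if n = m then 1 else 0 := by
  rcases le_total m n with h | h
  · obtain ⟨k, rfl⟩ := Nat.exists_eq_add_of_le h
    rw [integral_congr_ae (ae_norm.mono fun ζ hζ => pow_mul_conj_pow hζ m k), integral_pow]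
    simp
  · obtain ⟨k, rfl⟩ := Nat.exists_eq_add_of_le h
    have : ∀ᵐ ζ ∂circleMeasure, ζ ^ n * (starRingEnd ℂ ζ) ^ (n + k) = starRingEnd ℂ (ζ ^ k) := by
      refine ae_norm.mono fun ζ hζ => ?_
      rw [← pow_mul_conj_pow hζ n k]; simp [mul_comm]
    rw [integral_congr_ae this, integral_conj, integral_pow]
    by_cases hk : k = 0 <;> simp [hk]

/-- integrating a power series against an integrable function -/
lemma hasSum_integral_series {c : ℕ → ℂ} (hc : Summable fun n => ‖c n‖) {u : ℂ → ℂ}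
    (hu : Integrable u circleMeasure) :
    HasSum (fun n => c n * ∫ ζ, u ζ * ζ ^ n ∂circleMeasure)
      (∫ ζ, u ζ * ∑' n, c n * ζ ^ n ∂circleMeasure) := by
  have hi : ∀ n, Integrable (fun ζ => u ζ * ζ ^ n) circleMeasure := fun n =>
    hu.mul_bdd (c := 1) (by fun_prop) (ae_norm.mono fun ζ hζ => by simp [hζ])
  have hn : ∀ n, ∫ ζ, ‖c n * (u ζ * ζ ^ n)‖ ∂circleMeasure
      = ‖c n‖ * ∫ ζ, ‖u ζ‖ ∂circleMeasure := by
    intro n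
    rw [← integral_const_mul]
    exact integral_congr_ae (ae_norm.mono fun ζ hζ => by simp [hζ])
  have := hasSum_integral_of_summable_integral_norm
    (F := fun n ζ => c n * (u ζ * ζ ^ n)) (fun n => (hi n).const_mul (c n))
    (by simp_rw [hn]; exact hc.mul_right _)
  simp_rw [integral_const_mul] at this
  have e : ∫ ζ, u ζ * ∑' n, c n * ζ ^ n ∂circleMeasure
      = ∫ ζ, ∑' n, c n * (u ζ * ζ ^ n) ∂circleMeasure := by
    apply integral_congr_ae
    filter_upwards with ζ
    rw [← tsum_mul_left]
    exact tsum_congr fun n => by ring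
  rw [e]
  exact this

lemma summable_series {c : ℕ → ℂ} (hc : Summable fun n => ‖c n‖) {ζ : ℂ} (hζ : ‖ζ‖ ≤ 1) :
    Summable fun n => ‖c n * ζ ^ n‖ := by
  refine Summable.of_nonneg_of_le (fun _ => norm_nonneg _) (fun n => ?_) hc
  rw [norm_mul, norm_pow]
  exact mul_le_of_le_one_right (norm_nonneg _) (pow_le_one₀ (norm_nonneg _) hζ)

lemma norm_series_le {c : ℕ → ℂ} (hc : Summable fun n => ‖c n‖) {ζ : ℂ} (hζ : ‖ζ‖ ≤ 1) :
    ‖∑' n, c n * ζ ^ n‖ ≤ ∑' n, ‖c n‖ := by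
  refine (norm_tsum_le_tsum_norm (summable_series hc hζ)).trans ?_
  refine (summable_series hc hζ).tsum_le_tsum (fun n => ?_) hc
  rw [norm_mul, norm_pow]
  exact mul_le_of_le_one_right (norm_nonneg _) (pow_le_one₀ (norm_nonneg _) hζ)

lemma measurable_series (c : ℕ → ℂ) : Measurable (fun ζ : ℂ => ∑' n, c n * ζ ^ n) := by
  exact Measurable.tsum (fun n => by fun_prop)

lemma integrable_series {c : ℕ → ℂ} (hc : Summable fun n => ‖c n‖) :
    Integrable (fun ζ => ∑' n, c n * ζ ^ n) circleMeasure :=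
  Integrable.of_bound (measurable_series c).aestronglyMeasurable _
    (ae_norm.mono fun _ hζ => norm_series_le hc hζ.le)

lemma parseval {c : ℕ → ℂ} (hc : Summable fun n => ‖c n‖) :
    HasSum (fun n => ‖c n‖ ^ 2) (∫ ζ, ‖∑' n, c n * ζ ^ n‖ ^ 2 ∂circleMeasure) := by
  have hG := integrable_series hc
  have hG' : Integrable (fun ζ => starRingEnd ℂ (∑' n, c n * ζ ^ n)) circleMeasure :=
    Complex.conjCLE.toContinuousLinearMap.integrable_comp hG
  have h1 := hasSum_integral_series hc hG'
  have h2 : ∀ n, ∫ ζ, starRingEnd ℂ (∑' n, c n * ζ ^ n) * ζ ^ n ∂circleMeasure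
      = starRingEnd ℂ (c n) := by
    intro n
    have h3 := hasSum_integral_series hc (u := fun ζ => (starRingEnd ℂ ζ) ^ n)
      (Integrable.of_bound (by fun_prop) 1 (ae_norm.mono fun ζ hζ => by simp [hζ]))
    have h4 : ∫ ζ, (starRingEnd ℂ ζ) ^ n * ∑' n, c n * ζ ^ n ∂circleMeasure = c n := by
      refine h3.unique ?_
      convert hasSum_ite_eq n (c n) using 2 with k
      simp_rw [mul_comm (starRingEnd ℂ _ ^ n) _]
      rw [integral_pow_conj]
      by_cases hk : k = n <;> simp [hk]
    rw [← h4, ← integral_conj]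
    refine integral_congr_ae (Eventually.of_forall fun ζ => by simp [mul_comm])
  simp_rw [h2, Complex.mul_conj', Complex.conj_mul'] at h1
  have h5 := Complex.hasSum_re h1
  convert h5 using 1
  · funext n; rw [← Complex.ofReal_pow, Complex.ofReal_re]
  · simp_rw [← Complex.ofReal_pow]
    rw [integral_complex_ofReal, Complex.ofReal_re]

lemma lintegral_parseval {c : ℕ → ℂ} (hc : Summable fun n => ‖c n‖) :
    ∫⁻ ζ, ENNReal.ofReal (‖∑' n, c n * ζ ^ n‖ ^ 2) ∂circleMeasure
      = ENNReal.ofReal (∑' n, ‖c n‖ ^ 2) := by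
  rw [(parseval hc).tsum_eq, ofReal_integral_eq_lintegral_ofReal]
  · refine Integrable.of_bound ((measurable_series c).norm.pow_const 2).aestronglyMeasurable
      ((∑' n, ‖c n‖) ^ 2) (ae_norm.mono fun ζ hζ => ?_)
    rw [norm_pow, norm_norm]
    exact pow_le_pow_left₀ (norm_nonneg _) (norm_series_le hc hζ.le) 2
  · exact Eventually.of_forall fun _ => by positivity


/-! ### The Landau coefficients -/

/-- Coefficients of `(1-x)^(-1/2)`. -/
noncomputable def bet : ℕ → ℝ
  | 0 => 1
  | n + 1 => bet n * ((2 * n + 1) / (2 * n + 2))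

lemma bet_pos (n : ℕ) : 0 < bet n := by
  induction n with
  | zero => simp [bet]
  | succ n ih => rw [bet]; positivity

lemma bet_sq_le (n : ℕ) : bet n ^ 2 ≤ 1 / ((n : ℝ) + 1) := by
  induction n with
  | zero => simp [bet]
  | succ n ih =>
    rw [bet, mul_pow]
    calc bet n ^ 2 * ((2 * n + 1) / (2 * n + 2) : ℝ) ^ 2
        ≤ 1 / ((n : ℝ) + 1) * ((2 * n + 1) / (2 * n + 2) : ℝ) ^ 2 := by gcongr
      _ ≤ _ := by
        push_cast
        rw [div_pow, div_mul_div_comm, div_le_div_iff₀ (by positivity) (by positivity)]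
        have : (0 : ℝ) ≤ n := Nat.cast_nonneg n
        nlinarith [mul_nonneg this this]

lemma bet_conv (n : ℕ) : ∑ p ∈ Finset.HasAntidiagonal.antidiagonal n, bet p.1 * bet p.2 = 1 := by
  set B : PowerSeries ℝ := PowerSeries.mk bet with hB
  have hd : 2 * (1 - PowerSeries.X) * PowerSeries.derivative ℝ B = B := by
    ext n
    rw [mul_assoc, sub_mul, one_mul]
    have h2 : (2 : PowerSeries ℝ) = PowerSeries.C (2 : ℝ) := (map_ofNat PowerSeries.C 2).symm
    rw [h2, PowerSeries.coeff_C_mul, map_sub]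
    cases n with
    | zero =>
      simp [PowerSeries.coeff_derivative, hB, bet]
    | succ n =>
      rw [PowerSeries.coeff_succ_X_mul]
      simp only [PowerSeries.coeff_derivative, hB, PowerSeries.coeff_mk]
      rw [bet]
      push_cast
      field_simp
      ring
  have h1 : B * B * (1 - PowerSeries.X) = 1 := by
    apply PowerSeries.derivative.ext
    · simp only [Derivation.leibniz, map_sub, PowerSeries.derivative_X, smul_eq_mul,
        Derivation.map_one_eq_zero]
      linear_combination B * hd
    · simp [hB, bet]
  have h2 : B * B = PowerSeries.mk 1 := by
    have := PowerSeries.mk_one_mul_one_sub_eq_one ℝ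
    calc B * B = B * B * (PowerSeries.mk 1 * (1 - PowerSeries.X)) := by rw [this, mul_one]
      _ = (B * B * (1 - PowerSeries.X)) * PowerSeries.mk 1 := by ring
      _ = _ := by rw [h1, one_mul]
  have h3 := congrArg (PowerSeries.coeff n) h2
  rw [PowerSeries.coeff_mul] at h3
  simpa [hB] using h3

/-- truncated coefficients -/
noncomputable def betT (N k : ℕ) : ℝ := if k < N then bet k else 0

/-- coefficients of the square of the truncated series -/
noncomputable def gam (N k : ℕ) : ℝ := ∑ p ∈ Finset.HasAntidiagonal.antidiagonal k, betT N p.1 * betT N p.2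

lemma gam_eq_one {N k : ℕ} (h : k < N) : gam N k = 1 := by
  rw [← bet_conv k, gam]
  refine Finset.sum_congr rfl fun p hp => ?_
  have := Finset.HasAntidiagonal.mem_antidiagonal.1 hp
  rw [betT, betT, if_pos (by omega), if_pos (by omega)]

lemma gam_eq_zero {N k : ℕ} (h : 2 * N ≤ k) : gam N k = 0 := by
  rw [gam]
  refine Finset.sum_eq_zero fun p hp => ?_
  have := Finset.HasAntidiagonal.mem_antidiagonal.1 hp
  rw [betT, betT]
  by_cases h1 : p.1 < N
  · rw [if_neg (show ¬ p.2 < N by omega), mul_zero]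
  · rw [if_neg h1, zero_mul]

/-- the Landau polynomial -/
noncomputable def qN (N : ℕ) (x : ℂ) : ℂ := ∑ k ∈ Finset.range N, (bet k : ℂ) * x ^ k

lemma qN_eq_tsum (N : ℕ) (x : ℂ) : qN N x = ∑' k, (betT N k : ℂ) * x ^ k := by
  rw [tsum_eq_sum (s := Finset.range N)]
  · refine Finset.sum_congr rfl fun k hk => ?_
    rw [betT, if_pos (Finset.mem_range.1 hk)]
  · intro k hk
    rw [betT, if_neg (by simpa using hk)]; simp

lemma summable_betT (N : ℕ) (x : ℂ) : Summable fun k => ‖(betT N k : ℂ) * x ^ k‖ := by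
  refine summable_of_ne_finset_zero (s := Finset.range N) fun k hk => ?_
  rw [betT, if_neg (by simpa using hk)]; simp

lemma qN_sq (N : ℕ) (x : ℂ) : HasSum (fun k => (gam N k : ℂ) * x ^ k) (qN N x ^ 2) := by
  have h1 := tsum_mul_tsum_eq_tsum_sum_antidiagonal_of_summable_norm
    (summable_betT N x) (summable_betT N x)
  have h2 : ∀ k, ∑ p ∈ Finset.HasAntidiagonal.antidiagonal k,
      (betT N p.1 : ℂ) * x ^ p.1 * ((betT N p.2 : ℂ) * x ^ p.2) = (gam N k : ℂ) * x ^ k := by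
    intro k
    rw [gam]; push_cast
    rw [Finset.sum_mul]
    refine Finset.sum_congr rfl fun p hp => ?_
    rw [← Finset.HasAntidiagonal.mem_antidiagonal.1 hp, pow_add]; ring
  simp_rw [h2] at h1
  rw [sq, qN_eq_tsum, h1]
  refine Summable.hasSum ?_
  refine summable_of_ne_finset_zero (s := Finset.range (2 * N)) fun k hk => ?_
  rw [gam_eq_zero (by simpa using hk)]; simp

/-- The error series. -/
lemma hasSum_err (N : ℕ) {x : ℂ} (hx : ‖x‖ < 1) :
    HasSum (fun k => ((1 - gam N k : ℝ) : ℂ) * x ^ k) ((1 - x)⁻¹ - qN N x ^ 2) := by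
  have h := (hasSum_geometric_of_norm_lt_one hx).sub (qN_sq N x)
  have e : (fun k => ((1 - gam N k : ℝ) : ℂ) * x ^ k) = fun k => x ^ k - (gam N k : ℂ) * x ^ k := by
    funext k; push_cast; ring
  rw [e]; exact h

/-- Harmonic-type numbers as reals. -/
noncomputable def Hm (N : ℕ) : ℝ := ∑ k ∈ Finset.range N, 1 / ((k : ℝ) + 1)

lemma qN_lintegral (N : ℕ) {a : ℂ} (ha : ‖a‖ ≤ 1) :
    ∫⁻ η, ENNReal.ofReal (‖qN N (a * starRingEnd ℂ η)‖ ^ 2) ∂circleMeasure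
      ≤ ENNReal.ofReal (Hm N) := by
  have h1 : ∀ η, ‖qN N (a * starRingEnd ℂ η)‖
      = ‖∑' k, ((betT N k : ℂ) * (starRingEnd ℂ a) ^ k) * η ^ k‖ := by
    intro η
    rw [← Complex.norm_conj, qN]
    congr 1
    rw [tsum_eq_sum (s := Finset.range N)]
    · rw [map_sum]
      refine Finset.sum_congr rfl fun k hk => ?_
      rw [betT, if_pos (Finset.mem_range.1 hk)]
      simp [mul_pow, mul_assoc]
    · intro k hk
      rw [betT, if_neg (by simpa using hk)]; simp
  simp_rw [h1]
  rw [lintegral_parseval (summable_betT N _)]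
  refine ENNReal.ofReal_le_ofReal ?_
  rw [tsum_eq_sum (s := Finset.range N)]
  · refine Finset.sum_le_sum fun k hk => ?_
    rw [betT, if_pos (Finset.mem_range.1 hk)]
    refine le_trans ?_ (bet_sq_le k)
    rw [norm_mul, Complex.norm_real, Real.norm_eq_abs, abs_of_pos (bet_pos k), mul_pow]
    refine mul_le_of_le_one_right (by positivity) ?_
    refine pow_le_one₀ (norm_nonneg _) ?_
    rw [norm_pow, Complex.norm_conj]
    exact pow_le_one₀ (norm_nonneg _) ha
  · intro k hk
    rw [betT, if_neg (by simpa using hk)]; simp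

lemma poisson_lintegral {r : ℝ} (hr0 : 0 < r) (hr : r < 1) {a : ℂ} (ha : ‖a‖ = r) :
    ∫⁻ η, ENNReal.ofReal ((1 - r ^ 2) * ‖(1 - a * η)⁻¹‖ ^ 2) ∂circleMeasure = 1 := by
  have hs : Summable fun n => ‖a ^ n‖ := by
    simp_rw [norm_pow, ha]; exact summable_geometric_of_lt_one hr0.le hr
  have h1 : ∀ᵐ η ∂circleMeasure, ENNReal.ofReal ((1 - r ^ 2) * ‖(1 - a * η)⁻¹‖ ^ 2)
      = ENNReal.ofReal (1 - r ^ 2) * ENNReal.ofReal (‖∑' k, a ^ k * η ^ k‖ ^ 2) := by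
    refine ae_norm.mono fun η hη => ?_
    rw [← ENNReal.ofReal_mul (by nlinarith)]
    simp_rw [← mul_pow]
    rw [tsum_geometric_of_norm_lt_one (by rw [norm_mul, ha, hη]; simpa using hr)]
  rw [lintegral_congr_ae h1, lintegral_const_mul' _ _ ENNReal.ofReal_ne_top, lintegral_parseval hs,
    ← ENNReal.ofReal_mul (by nlinarith)]
  have : ∀ n : ℕ, ‖a ^ n‖ ^ 2 = (r ^ 2) ^ n := fun n => by
    rw [norm_pow, ha, ← pow_mul, ← pow_mul, mul_comm]
  simp_rw [this]
  rw [tsum_geometric_of_lt_one (by positivity) (by nlinarith), mul_inv_cancel₀ (by nlinarith)]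
  simp


/-! ### Abel summation and weights -/

lemma abel {R : Type*} [CommRing R] (α a : ℕ → R) (N : ℕ) :
    ∑ n ∈ Finset.range N, a n * α n
      = ∑ n ∈ Finset.range N, (α n - 2 * α (n + 1) + α (n + 2)) *
          (∑ k ∈ Finset.range (n + 1), ∑ j ∈ Finset.range (k + 1), a j)
        + (α N - α (N + 1)) * (∑ k ∈ Finset.range N, ∑ j ∈ Finset.range (k + 1), a j)
        + α N * ∑ j ∈ Finset.range N, a j := by
  induction N with
  | zero => simp
  | succ N ih =>
    rw [Finset.sum_range_succ, ih, Finset.sum_range_succ (fun n => (α n - 2 * α (n + 1) + α (n + 2)) *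
          (∑ k ∈ Finset.range (n + 1), ∑ j ∈ Finset.range (k + 1), a j)),
      Finset.sum_range_succ (fun k => ∑ j ∈ Finset.range (k + 1), a j) N,
      Finset.sum_range_succ a N]
    ring

lemma Hm_succ (m : ℕ) : Hm (m + 1) = Hm m + 1 / ((m : ℝ) + 1) := by
  rw [Hm, Finset.sum_range_succ]; rfl

lemma one_le_Hm (m : ℕ) : 1 ≤ Hm (m + 1) := by
  induction m with
  | zero => simp [Hm]
  | succ m ih => rw [Hm_succ]; have : (0 : ℝ) ≤ 1 / (((m + 1 : ℕ) : ℝ) + 1) := by positivity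
                 linarith

lemma weight_le (m : ℕ) : (m : ℝ) * (1 + Hm m)
    ≤ ∑ k ∈ Finset.range m, ∑ j ∈ Finset.range (k + 1), 12 / ((j : ℝ) + 1) := by
  induction m with
  | zero => simp
  | succ m ih =>
    rw [Finset.sum_range_succ]
    have h1 : ∑ j ∈ Finset.range (m + 1), 12 / ((j : ℝ) + 1) = 12 * Hm (m + 1) := by
      rw [Hm, Finset.mul_sum]; exact Finset.sum_congr rfl fun j _ => by ring
    have h2 := one_le_Hm m
    have h3 := Hm_succ m
    have h4 : (m : ℝ) * Hm m = m * Hm (m + 1) - m / ((m : ℝ) + 1) := by rw [h3]; ring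
    have h5 : (m : ℝ) / ((m : ℝ) + 1) ≤ 1 := by
      rw [div_le_one (by positivity)]; linarith
    rw [h1]; push_cast
    nlinarith

section seq
variable {α : ℕ → ℝ}

/-- second difference weighted by `n+1` -/
noncomputable def dw (α : ℕ → ℝ) (n : ℕ) : ℝ := (α n - 2 * α (n + 1) + α (n + 2)) * (n + 1)

lemma dw_nonneg
    (hconc : ∀ n, 0 ≤ α n - 2 * α (n + 1) + α (n + 2)) (n : ℕ) : 0 ≤ dw α n := mul_nonneg (hconc n) (by positivity)

lemma weighted_partial
    (hpos : ∀ n, 0 < α n)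
    (hdec : ∀ n, α (n + 1) ≤ α n)
    (hconc : ∀ n, 0 ≤ α n - 2 * α (n + 1) + α (n + 2))
    (hsum : Summable fun n => α n / ((n : ℝ) + 1)) (N : ℕ) : ∑ n ∈ Finset.range N, dw α n * (1 + Hm (n + 1))
    ≤ 12 * ∑' n, α n / ((n : ℝ) + 1) := by
  have h := abel α (fun n => 12 / ((n : ℝ) + 1)) N
  have h1 : ∑ n ∈ Finset.range N, dw α n * (1 + Hm (n + 1))
      ≤ ∑ n ∈ Finset.range N, (α n - 2 * α (n + 1) + α (n + 2)) *
          (∑ k ∈ Finset.range (n + 1), ∑ j ∈ Finset.range (k + 1), 12 / ((j : ℝ) + 1)) := by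
    refine Finset.sum_le_sum fun n _ => ?_
    have := weight_le (n + 1)
    rw [dw, mul_assoc]
    push_cast at this
    exact mul_le_mul_of_nonneg_left this (hconc n)
  have h2 : 0 ≤ (α N - α (N + 1)) *
      (∑ k ∈ Finset.range N, ∑ j ∈ Finset.range (k + 1), 12 / ((j : ℝ) + 1)) :=
    mul_nonneg (by linarith [hdec N])
      (Finset.sum_nonneg fun k _ => Finset.sum_nonneg fun j _ => by positivity)
  have h3 : 0 ≤ α N * ∑ j ∈ Finset.range N, 12 / ((j : ℝ) + 1) :=
    mul_nonneg (hpos N).le (by positivity)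
  have h4 : ∑ n ∈ Finset.range N, 12 / ((n : ℝ) + 1) * α n
      = 12 * ∑ n ∈ Finset.range N, α n / ((n : ℝ) + 1) := by
    rw [Finset.mul_sum]; exact Finset.sum_congr rfl fun j _ => by ring
  have h5 := hsum.sum_le_tsum (Finset.range N) fun n _ => (div_nonneg (hpos n).le (by positivity))
  linarith

lemma weighted_summable
    (hpos : ∀ n, 0 < α n)
    (hdec : ∀ n, α (n + 1) ≤ α n)
    (hconc : ∀ n, 0 ≤ α n - 2 * α (n + 1) + α (n + 2))
    (hsum : Summable fun n => α n / ((n : ℝ) + 1)) : Summable fun n => dw α n * (1 + Hm (n + 1)) :=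
  summable_of_sum_range_le
    (fun n => mul_nonneg (dw_nonneg hconc n) (by linarith [one_le_Hm n]))
    (weighted_partial hpos hdec hconc hsum)

lemma weighted_tsum_le
    (hpos : ∀ n, 0 < α n)
    (hdec : ∀ n, α (n + 1) ≤ α n)
    (hconc : ∀ n, 0 ≤ α n - 2 * α (n + 1) + α (n + 2))
    (hsum : Summable fun n => α n / ((n : ℝ) + 1)) : ∑' n, dw α n * (1 + Hm (n + 1)) ≤ 12 * ∑' n, α n / ((n : ℝ) + 1) :=
  Real.tsum_le_of_sum_range_le
    (fun n => mul_nonneg (dw_nonneg hconc n) (by linarith [one_le_Hm n]))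
    (weighted_partial hpos hdec hconc hsum)

lemma dw_summable
    (hpos : ∀ n, 0 < α n)
    (hdec : ∀ n, α (n + 1) ≤ α n)
    (hconc : ∀ n, 0 ≤ α n - 2 * α (n + 1) + α (n + 2))
    (hsum : Summable fun n => α n / ((n : ℝ) + 1)) : Summable (dw α) :=
  Summable.of_nonneg_of_le (dw_nonneg hconc)
    (fun n => le_mul_of_one_le_right (dw_nonneg hconc n) (by linarith [one_le_Hm n]))
    (weighted_summable hpos hdec hconc hsum)

lemma alpha_tendsto
    (hpos : ∀ n, 0 < α n)
    (hdec : ∀ n, α (n + 1) ≤ α n)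
    (hsum : Summable fun n => α n / ((n : ℝ) + 1)) : Tendsto α atTop (𝓝 0) := by
  have hanti : Antitone α := antitone_nat_of_succ_le hdec
  have hlim := tendsto_atTop_ciInf hanti ⟨0, by rintro _ ⟨n, rfl⟩; exact (hpos n).le⟩
  set L := ⨅ n, α n with hL
  have hle : ∀ n, L ≤ α n := fun n => hanti.le_of_tendsto hlim n
  have hL0 : 0 ≤ L := le_ciInf fun n => (hpos n).le
  rcases hL0.eq_or_lt with h | h
  · rwa [← h] at hlim
  · exfalso
    have h1 : Summable fun n : ℕ => L * (1 / ((n : ℝ) + 1)) := by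
      refine Summable.of_nonneg_of_le (fun n => by positivity) (fun n => ?_) hsum
      rw [mul_one_div]
      exact div_le_div_of_nonneg_right (hle n) (by positivity)
    have h2 := (summable_mul_left_iff h.ne').1 h1
    have h3 := (summable_nat_add_iff 1 (f := fun n : ℕ => 1 / (n : ℝ))).1 (by simpa using h2)
    exact Real.not_summable_one_div_natCast h3

lemma delta_tendsto
    (hpos : ∀ n, 0 < α n)
    (hdec : ∀ n, α (n + 1) ≤ α n)
    (hconc : ∀ n, 0 ≤ α n - 2 * α (n + 1) + α (n + 2))
    (hsum : Summable fun n => α n / ((n : ℝ) + 1)) : Tendsto (fun N : ℕ => (α N - α (N + 1)) * N) atTop (𝓝 0) := by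
  have hdl : Antitone fun n => α n - α (n + 1) :=
    antitone_nat_of_succ_le fun n => by have := hconc n; ring_nf at this ⊢; linarith
  have hb : ∀ N : ℕ, (α N - α (N + 1)) * N ≤ 3 * α (N / 2) := by
    intro N
    have key : ∀ m k : ℕ, m * (α (k + m) - α (k + m + 1)) ≤ α k - α (k + m) := by
      intro m k
      induction m with
      | zero => simp
      | succ m ih =>
        have h1 := hdl (show k + m ≤ k + m + 1 by omega)
        have h2 : (m : ℝ) * (α (k + m + 1) - α (k + m + 1 + 1))
          ≤ m * (α (k + m) - α (k + m + 1)) := mul_le_mul_of_nonneg_left h1 (Nat.cast_nonneg m)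
        simp only at h1
        push_cast
        rw [← add_assoc]
        linarith
    have h1 := key (N - N / 2) (N / 2)
    rw [show N / 2 + (N - N / 2) = N by omega] at h1
    have h2 : (N : ℝ) ≤ 2 * ((N - N / 2 : ℕ) : ℝ) := by
      have : N ≤ 2 * (N - N / 2) := by omega
      exact_mod_cast this
    have h3 : 0 ≤ α N - α (N + 1) := by linarith [hdec N]
    nlinarith [hpos N, hpos (N / 2)]
  have h0 : Tendsto (fun N : ℕ => 3 * α (N / 2)) atTop (𝓝 0) := by
    have := ((alpha_tendsto hpos hdec hsum).comp
      (Nat.tendsto_div_const_atTop (n := 2) (by norm_num))).const_mul 3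
    simpa using this
  refine squeeze_zero (fun N => ?_) hb h0
  exact mul_nonneg (by linarith [hdec N]) (Nat.cast_nonneg N)

end seq

/-! ### Fejér -/

lemma coeff_shift {a : ℕ → ℂ} (ha : Summable fun n => ‖a n‖) (k j : ℕ) :
    ∫ η, (η ^ k * (starRingEnd ℂ η) ^ j) * ∑' n, a n * η ^ n ∂circleMeasure
      = if k ≤ j then a (j - k) else 0 := by
  have h := hasSum_integral_series ha (u := fun η => η ^ k * (starRingEnd ℂ η) ^ j)
    (Integrable.of_bound (by fun_prop) 1 (ae_norm.mono fun ζ hζ => by simp [hζ]))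
  have e : ∀ n, ∫ η, (η ^ k * (starRingEnd ℂ η) ^ j) * η ^ n ∂circleMeasure
      = if k + n = j then 1 else 0 := by
    intro n
    rw [← integral_pow_conj]
    congr 1; funext η; ring
  simp_rw [e] at h
  refine h.unique ?_
  split_ifs with hkj
  · convert hasSum_ite_eq (j - k) (a (j - k)) using 2 with n
    by_cases hn : n = j - k
    · subst hn; rw [if_pos (by omega)]; simp
    · rw [if_neg (by omega), if_neg hn]; simp
  · convert hasSum_zero using 2 with n
    rw [if_neg (by omega)]; simp

lemma fejer {a : ℕ → ℂ} (ha : Summable fun n => ‖a n‖) {M : ℝ}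
    (hM : ∀ η : ℂ, ‖η‖ = 1 → ‖∑' n, a n * η ^ n‖ ≤ M) (N : ℕ) :
    ‖∑ j ∈ Finset.range N, ∑ k ∈ Finset.range (j + 1), a k‖ ≤ M * N := by
  set D : ℂ → ℂ := fun η => ∑ k ∈ Finset.range N, η ^ k with hD
  set F : ℂ → ℂ := fun η => ∑' n, a n * η ^ n with hF
  have hFi : Integrable F circleMeasure := integrable_series ha
  have hIm : ∀ k j : ℕ, Integrable (fun η => (η ^ k * (starRingEnd ℂ η) ^ j) * F η)
      circleMeasure := fun k j =>
    hFi.bdd_mul (c := 1) (by fun_prop) (ae_norm.mono fun ζ hζ => by simp [hζ])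
  have h1 : ∑ j ∈ Finset.range N, ∑ k ∈ Finset.range (j + 1), a k
      = ∫ η, (D η * starRingEnd ℂ (D η)) * F η ∂circleMeasure := by
    have e : ∀ η, (D η * starRingEnd ℂ (D η)) * F η
        = ∑ j ∈ Finset.range N, ∑ k ∈ Finset.range N, (η ^ k * (starRingEnd ℂ η) ^ j) * F η := by
      intro η
      simp only [hD, map_sum, map_pow]
      rw [Finset.sum_mul_sum, Finset.sum_mul, Finset.sum_comm]
      refine Finset.sum_congr rfl fun j _ => ?_
      rw [Finset.sum_mul]
    simp_rw [e]
    rw [integral_finsetSum _ fun j _ => integrable_finsetSum _ fun k _ => hIm k j]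
    refine Finset.sum_congr rfl fun j hj => ?_
    rw [integral_finsetSum _ fun k _ => hIm k j]
    simp_rw [hF, coeff_shift ha]
    rw [← Finset.sum_filter, ← Finset.sum_range_reflect]
    have hj' := Finset.mem_range.1 hj
    refine Finset.sum_congr ?_ fun k hk => by congr 1
    ext k; simp only [Finset.mem_range, Finset.mem_filter]; omega
  have hc : Summable fun n => ‖(if n < N then (1 : ℂ) else 0)‖ := by
    refine summable_of_ne_finset_zero (s := Finset.range N) fun k hk => ?_
    rw [if_neg (by simpa using hk)]; simp
  have hDe : ∀ η, D η = ∑' n, (if n < N then (1 : ℂ) else 0) * η ^ n := by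
    intro η
    rw [tsum_eq_sum (s := Finset.range N)]
    · refine Finset.sum_congr rfl fun k hk => ?_
      rw [if_pos (Finset.mem_range.1 hk), one_mul]
    · intro k hk
      rw [if_neg (by simpa using hk), zero_mul]
  have h2 : ∫ η, ‖D η‖ ^ 2 ∂circleMeasure = N := by
    simp_rw [hDe]
    rw [← (parseval hc).tsum_eq, tsum_eq_sum (s := Finset.range N)]
    · rw [Finset.sum_congr rfl (g := fun _ => (1 : ℝ))]
      · simp
      · intro k hk; rw [if_pos (Finset.mem_range.1 hk)]; simp
    · intro k hk
      rw [if_neg (by simpa using hk)]; simp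
  have hDb : ∀ η : ℂ, ‖η‖ = 1 → ‖D η‖ ≤ N := fun η hη => by
    refine (norm_sum_le _ _).trans ?_
    simp [hη]
  have hDi : Integrable (fun η => ‖D η‖ ^ 2) circleMeasure :=
    Integrable.of_bound (by fun_prop) ((N : ℝ) ^ 2) (ae_norm.mono fun η hη => by
      rw [norm_pow, norm_norm]; exact pow_le_pow_left₀ (norm_nonneg _) (hDb η hη) 2)
  rw [h1, ← h2, ← integral_const_mul]
  refine norm_integral_le_of_norm_le (hDi.const_mul M) (ae_norm.mono fun η hη => ?_)
  rw [norm_mul, norm_mul, Complex.norm_conj, ← sq, mul_comm]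
  exact mul_le_mul_of_nonneg_right (hM η hη) (by positivity)

section cesaroSec
variable {f : ℂ → ℂ}

lemma taylor_hasSum
    (hf : DifferentiableOn ℂ f (Metric.ball (0 : ℂ) 1)) {z : ℂ} (hz : ‖z‖ < 1) :
    HasSum (fun n => taylorCoeff f n * z ^ n) (f z) := by
  have h := Complex.hasSum_taylorSeries_on_ball (c := 0) (r := 1) (f := f) (z := z) (by simpa using hf)
    (by simpa using hz)
  have e : (fun n => taylorCoeff f n * z ^ n)
      = fun n : ℕ => ((n.factorial : ℂ)⁻¹ • (z - 0) ^ n • iteratedDeriv n f 0) := by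
    funext n
    simp only [taylorCoeff, smul_eq_mul, sub_zero]; ring
  rw [e]; exact h

lemma taylor_summable
    (hf : DifferentiableOn ℂ f (Metric.ball (0 : ℂ) 1)) {z : ℂ} (hz : ‖z‖ < 1) :
    Summable (fun n => ‖taylorCoeff f n * z ^ n‖) := (taylor_hasSum hf hz).summable.norm

lemma norm_le_eSup (hfb : eSupAbs f ≠ ⊤) {z : ℂ} (hz : ‖z‖ < 1) :
    ‖f z‖ ≤ (eSupAbs f).toReal := by
  refine (ENNReal.ofReal_le_iff_le_toReal hfb).1 ?_
  exact le_iSup₂ (f := fun z (_ : z ∈ Metric.ball (0 : ℂ) 1) => ENNReal.ofReal ‖f z‖) z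
    (by simpa using hz)

lemma continuous_cesaro (n : ℕ) : Continuous (cesaro f n) := by
  unfold cesaro taylorPartial; fun_prop

lemma cesaro_norm_lt
    (hf : DifferentiableOn ℂ f (Metric.ball (0 : ℂ) 1)) (hfb : eSupAbs f ≠ ⊤) (n : ℕ) {z : ℂ} (hz : ‖z‖ < 1) :
    ‖cesaro f n z‖ ≤ (eSupAbs f).toReal := by
  have h := fejer (taylor_summable hf hz) (M := (eSupAbs f).toReal) (N := n + 1) (by
    intro η hη
    have hz' : ‖z * η‖ < 1 := by rw [norm_mul, hη, mul_one]; exact hz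
    simp_rw [mul_assoc, ← mul_pow]
    rw [(taylor_hasSum hf hz').tsum_eq]
    exact norm_le_eSup hfb hz')
  have hn : (0 : ℝ) < n + 1 := by positivity
  have e : ‖((n : ℂ) + 1)⁻¹‖ = ((n : ℝ) + 1)⁻¹ := by
    rw [norm_inv]; congr 1
    rw [show (n : ℂ) + 1 = ((n + 1 : ℝ) : ℂ) by push_cast; rfl, Complex.norm_real,
      Real.norm_of_nonneg hn.le]
  rw [cesaro, norm_mul, e, inv_mul_le_iff₀ hn, mul_comm]
  simpa [taylorPartial] using h

lemma cesaro_norm_le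
    (hf : DifferentiableOn ℂ f (Metric.ball (0 : ℂ) 1)) (hfb : eSupAbs f ≠ ⊤) (n : ℕ) {z : ℂ} (hz : ‖z‖ ≤ 1) :
    ‖cesaro f n z‖ ≤ (eSupAbs f).toReal := by
  have hcl : z ∈ closure (Metric.ball (0 : ℂ) 1) := by
    rw [closure_ball _ one_ne_zero]; simpa using hz
  refine closure_minimal (t := {z | ‖cesaro f n z‖ ≤ (eSupAbs f).toReal}) ?_ ?_ hcl
  · intro w hw; exact cesaro_norm_lt hf hfb n (by simpa using hw)
  · exact isClosed_le (continuous_cesaro n).norm continuous_const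

variable {α : ℕ → ℝ}

/-- the boundary function (defined on the closed disc) -/
noncomputable def gB (f : ℂ → ℂ) (α : ℕ → ℝ) (z : ℂ) : ℂ := ∑' n, (dw α n : ℂ) * cesaro f n z

lemma gB_term_le
    (hf : DifferentiableOn ℂ f (Metric.ball (0 : ℂ) 1))
    (hconc : ∀ n, 0 ≤ α n - 2 * α (n + 1) + α (n + 2)) (hfb : eSupAbs f ≠ ⊤) (n : ℕ) {z : ℂ} (hz : ‖z‖ ≤ 1) :
    ‖(dw α n : ℂ) * cesaro f n z‖ ≤ dw α n * (eSupAbs f).toReal := by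
  rw [norm_mul, Complex.norm_real, Real.norm_of_nonneg (dw_nonneg hconc n)]
  exact mul_le_mul_of_nonneg_left (cesaro_norm_le hf hfb n hz) (dw_nonneg hconc n)

lemma gB_continuousOn
    (hf : DifferentiableOn ℂ f (Metric.ball (0 : ℂ) 1))
    (hpos : ∀ n, 0 < α n)
    (hdec : ∀ n, α (n + 1) ≤ α n)
    (hconc : ∀ n, 0 ≤ α n - 2 * α (n + 1) + α (n + 2))
    (hsum : Summable fun n => α n / ((n : ℝ) + 1)) (hfb : eSupAbs f ≠ ⊤) : ContinuousOn (gB f α) (Metric.closedBall 0 1) := by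
  refine continuousOn_tsum (u := fun n => dw α n * (eSupAbs f).toReal)
    (fun n => ((continuous_cesaro n).const_smul (dw α n : ℂ)).continuousOn)
    ((dw_summable hpos hdec hconc hsum).mul_right _) ?_
  intro n z hz
  exact gB_term_le hf hconc hfb n (by simpa using hz)

lemma seqConv_eq
    (hf : DifferentiableOn ℂ f (Metric.ball (0 : ℂ) 1))
    (hpos : ∀ n, 0 < α n)
    (hdec : ∀ n, α (n + 1) ≤ α n)
    (hconc : ∀ n, 0 ≤ α n - 2 * α (n + 1) + α (n + 2))
    (hsum : Summable fun n => α n / ((n : ℝ) + 1)) (hfb : eSupAbs f ≠ ⊤) {z : ℂ} (hz : ‖z‖ < 1) : seqConv f α z = gB f α z := by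
  set a : ℕ → ℂ := fun n => taylorCoeff f n * z ^ n with ha
  have has : Summable fun n => ‖a n‖ := taylor_summable hf hz
  have hα0 : ∀ n, α n ≤ α 0 := fun n => antitone_nat_of_succ_le hdec (Nat.zero_le n)
  have hs1 : Summable fun n => a n * (α n : ℂ) := by
    refine Summable.of_norm_bounded (has.mul_right (α 0)) fun n => ?_
    rw [norm_mul, Complex.norm_real, Real.norm_of_nonneg (hpos n).le]
    exact mul_le_mul_of_nonneg_left (hα0 n) (norm_nonneg _)
  have e1 : seqConv f α z = ∑' n, a n * (α n : ℂ) := by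
    rw [seqConv]; exact tsum_congr fun n => by simp only [ha]; ring
  have hs2 : Summable fun n => (dw α n : ℂ) * cesaro f n z :=
    Summable.of_norm_bounded ((dw_summable hpos hdec hconc hsum).mul_right _)
      fun n => gB_term_le hf hconc hfb n hz.le
  have t1 := hs1.hasSum.tendsto_sum_nat
  have t2 := hs2.hasSum.tendsto_sum_nat
  set B := ∑' n, ‖a n‖ with hB
  have hB0 : 0 ≤ B := tsum_nonneg fun n => norm_nonneg _
  have hS : ∀ N, ‖∑ j ∈ Finset.range N, a j‖ ≤ B := fun N =>
    (norm_sum_le _ _).trans (has.sum_le_tsum _ fun n _ => norm_nonneg _)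
  have hT : ∀ N : ℕ, ‖∑ k ∈ Finset.range N, ∑ j ∈ Finset.range (k + 1), a j‖ ≤ N * B := fun N => by
    refine (norm_sum_le _ _).trans ?_
    refine (Finset.sum_le_card_nsmul _ _ B fun k _ => hS _).trans ?_
    simp
  have hR : Tendsto (fun N : ℕ => ((α N : ℂ) - α (N + 1)) *
        (∑ k ∈ Finset.range N, ∑ j ∈ Finset.range (k + 1), a j)
        + (α N : ℂ) * ∑ j ∈ Finset.range N, a j) atTop (𝓝 0) := by
    have hb : Tendsto (fun N : ℕ => ((α N - α (N + 1)) * N) * B + α N * B) atTop (𝓝 0) := by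
      have := ((delta_tendsto hpos hdec hconc hsum).mul_const B).add
        ((alpha_tendsto hpos hdec hsum).mul_const B)
      simpa using this
    refine squeeze_zero_norm (fun N => ?_) hb
    refine (norm_add_le _ _).trans (add_le_add ?_ ?_)
    · rw [norm_mul, ← Complex.ofReal_sub, Complex.norm_real,
        Real.norm_of_nonneg (by linarith [hdec N]), mul_assoc]
      exact mul_le_mul_of_nonneg_left (hT N) (by linarith [hdec N])
    · rw [norm_mul, Complex.norm_real, Real.norm_of_nonneg (hpos N).le]
      exact mul_le_mul_of_nonneg_left (hS N) (hpos N).le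
  have t3 := t2.add hR
  rw [add_zero] at t3
  rw [e1, gB]
  refine tendsto_nhds_unique t1 (t3.congr fun N => ?_)
  rw [abel (fun n => (α n : ℂ)) a N, add_assoc]
  congr 1
  refine Finset.sum_congr rfl fun n _ => ?_
  have hn : (n : ℂ) + 1 ≠ 0 := by exact_mod_cast Nat.succ_ne_zero n
  simp only [dw, cesaro, taylorPartial, ha]
  push_cast
  field_simp

lemma gB_boundary
    (hf : DifferentiableOn ℂ f (Metric.ball (0 : ℂ) 1))
    (hpos : ∀ n, 0 < α n)
    (hdec : ∀ n, α (n + 1) ≤ α n)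
    (hconc : ∀ n, 0 ≤ α n - 2 * α (n + 1) + α (n + 2))
    (hsum : Summable fun n => α n / ((n : ℝ) + 1)) (hfb : eSupAbs f ≠ ⊤) : IsBoundaryFn (seqConv f α) (gB f α) := by
  refine ae_norm.mono fun ζ hζ => ?_
  have h1 : ContinuousWithinAt (gB f α) (Metric.closedBall 0 1) ζ :=
    gB_continuousOn hf hpos hdec hconc hsum hfb ζ (by simp [hζ])
  have h2 : Tendsto (fun r : ℝ => (r : ℂ) * ζ) (𝓝[<] 1) (𝓝[Metric.closedBall 0 1] ζ) := by
    refine tendsto_nhdsWithin_iff.2 ⟨?_, ?_⟩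
    · have : Tendsto (fun r : ℝ => (r : ℂ) * ζ) (𝓝 1) (𝓝 (((1 : ℝ) : ℂ) * ζ)) :=
        Continuous.tendsto (by fun_prop) _
      simp only [Complex.ofReal_one, one_mul] at this
      exact this.mono_left nhdsWithin_le_nhds
    · filter_upwards [Ioo_mem_nhdsLT (show (0 : ℝ) < 1 by norm_num)] with r hr
      simp [hζ, abs_of_pos hr.1, hr.2.le]
  refine (h1.tendsto.comp h2).congr' ?_
  filter_upwards [Ioo_mem_nhdsLT (show (0 : ℝ) < 1 by norm_num)] with r hr
  exact (seqConv_eq hf hpos hdec hconc hsum hfb (by simp [hζ, abs_of_pos hr.1, hr.2])).symm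

end cesaroSec


/-! ### Factorization and the vanishing of negative Fourier coefficients of `H¹` boundary values -/

/-- factorization property on the closed disc -/
def Fac (P : ℂ → ℂ) : Prop := ∃ a b : ℂ → ℂ, DiffContOnCl ℂ a (Metric.ball 0 1) ∧
  DiffContOnCl ℂ b (Metric.ball 0 1) ∧ (∀ z : ℂ, ‖z‖ ≤ 1 → P z = a z * b z) ∧
  ∀ z : ℂ, ‖z‖ = 1 → ‖a z‖ = ‖b z‖

lemma Fac.mul {P Q : ℂ → ℂ} (hP : Fac P) (hQ : Fac Q) : Fac (fun z => P z * Q z) := by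
  obtain ⟨a, b, ha, hb, h1, h2⟩ := hP
  obtain ⟨a', b', ha', hb', h1', h2'⟩ := hQ
  refine ⟨fun z => a z * a' z, fun z => b z * b' z, ha.smul ha', hb.smul hb', ?_, ?_⟩
  · intro z hz; simp only [h1 z hz, h1' z hz]; ring
  · intro z hz; simp only [norm_mul, h2 z hz, h2' z hz]

lemma Fac.congr {P Q : ℂ → ℂ} (hP : Fac P) (h : ∀ z : ℂ, ‖z‖ ≤ 1 → Q z = P z) : Fac Q := by
  obtain ⟨a, b, ha, hb, h1, h2⟩ := hP
  exact ⟨a, b, ha, hb, fun z hz => by rw [h z hz, h1 z hz], h2⟩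

lemma exists_sqrt (w : ℂ) : ∃ s : ℂ, s * s = w :=
  ⟨w ^ (((2 : ℕ) : ℂ)⁻¹), by rw [← sq]; exact Complex.cpow_nat_inv_pow w two_ne_zero⟩

lemma fac_const (c : ℂ) : Fac (fun _ => c) := by
  obtain ⟨s, hs⟩ := exists_sqrt c
  exact ⟨fun _ => s, fun _ => s, diffContOnCl_const, diffContOnCl_const, fun _ _ => hs.symm,
    fun _ _ => rfl⟩

/-- square root of `1 - a z` -/
noncomputable def sq1 (a z : ℂ) : ℂ := (1 - a * z) ^ (((2 : ℕ) : ℂ)⁻¹)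

lemma sq1_mul (a z : ℂ) : sq1 a z * sq1 a z = 1 - a * z := by
  rw [← sq]; exact Complex.cpow_nat_inv_pow _ two_ne_zero

lemma sq1_diff {a : ℂ} (ha : ‖a‖ ≤ 1) : DiffContOnCl ℂ (sq1 a) (Metric.ball 0 1) := by
  have hre : ∀ z : ℂ, (a * z).re ≤ ‖z‖ := fun z => by
    refine (Complex.re_le_norm _).trans ?_
    rw [norm_mul]; exact mul_le_of_le_one_left (norm_nonneg _) ha
  constructor
  · intro z hz
    have hz' : ‖z‖ < 1 := by simpa using hz
    refine DifferentiableAt.differentiableWithinAt ?_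
    unfold sq1
    refine DifferentiableAt.cpow_const ?_ ?_
    · fun_prop
    · left; simp only [Complex.sub_re, Complex.one_re]; linarith [hre z]
  · rw [closure_ball _ one_ne_zero]
    intro z hz
    have hz' : ‖z‖ ≤ 1 := by simpa using hz
    refine ContinuousAt.continuousWithinAt ?_
    unfold sq1
    have h1 : ContinuousAt (fun x : ℂ => x ^ (((2 : ℕ) : ℂ)⁻¹)) (1 - a * z) := by
      refine Complex.continuousAt_cpow_const_of_re_pos ?_ (by norm_num)
      left; simp only [Complex.sub_re, Complex.one_re]; linarith [hre z]
    exact ContinuousAt.comp (f := fun z => 1 - a * z) h1 (by fun_prop)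

lemma fac_linear (a : ℂ) : Fac (fun z => z - a) := by
  rcases le_or_gt 1 ‖a‖ with h | h
  · have ha : a ≠ 0 := by rintro rfl; norm_num at h
    have h2 : Fac (fun z => 1 - a⁻¹ * z) := by
      have : ‖a⁻¹‖ ≤ 1 := by rw [norm_inv]; exact inv_le_one_of_one_le₀ h
      exact ⟨sq1 a⁻¹, sq1 a⁻¹, sq1_diff this, sq1_diff this, fun z _ => (sq1_mul _ z).symm,
        fun _ _ => rfl⟩
    refine ((fac_const (-a)).mul h2).congr fun z _ => ?_
    field_simp; ring
  · have hc : ‖starRingEnd ℂ a‖ ≤ 1 := by rw [Complex.norm_conj]; exact h.le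
    have hne : ∀ z : ℂ, ‖z‖ ≤ 1 → 1 - starRingEnd ℂ a * z ≠ 0 := by
      intro z hz h0
      have h1 : ‖starRingEnd ℂ a * z‖ = 1 := by rw [← sub_eq_zero.1 h0]; simp
      rw [norm_mul, Complex.norm_conj] at h1
      nlinarith [norm_nonneg a, norm_nonneg z]
    refine ⟨fun z => ((z - a) * (1 - starRingEnd ℂ a * z)⁻¹) * sq1 (starRingEnd ℂ a) z,
      sq1 (starRingEnd ℂ a), ?_, sq1_diff hc, ?_, ?_⟩
    · refine DiffContOnCl.smul (𝕜' := ℂ) ?_ (sq1_diff hc)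
      refine DiffContOnCl.smul (𝕜' := ℂ) ?_ ?_
      · exact (Differentiable.diffContOnCl (by fun_prop))
      · refine DiffContOnCl.inv (Differentiable.diffContOnCl (by fun_prop)) ?_
        intro z hz
        rw [closure_ball _ one_ne_zero] at hz
        exact hne z (by simpa using hz)
    · intro z hz
      rw [mul_assoc, sq1_mul, mul_assoc, inv_mul_cancel₀ (hne z hz), mul_one]
    · intro z hz
      have h1 : ‖(z - a) * (1 - starRingEnd ℂ a * z)⁻¹‖ = 1 := by
        have h3 : 1 - starRingEnd ℂ a * z = z * starRingEnd ℂ (z - a) := by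
          have : z * starRingEnd ℂ z = 1 := by rw [Complex.mul_conj']; simp [hz]
          rw [map_sub, mul_sub, this]; ring
        have h4 := hne z hz.le
        rw [h3] at h4 ⊢
        have h5 : ‖z - a‖ ≠ 0 := by
          intro h0; apply h4; rw [norm_eq_zero.1 h0]; simp
        rw [norm_mul, norm_inv, norm_mul, Complex.norm_conj, hz, one_mul, mul_inv_cancel₀ h5]
      rw [norm_mul, h1, one_mul]

lemma fac_poly (p : Polynomial ℂ) : Fac (fun z => p.eval z) := by
  have h1 : ∀ s : Multiset ℂ, Fac (fun z => (s.map fun a => z - a).prod) := by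
    intro s
    induction s using Multiset.induction with
    | empty => simpa using fac_const 1
    | cons a s ih => simpa using (fac_linear a).mul ih
  refine ((fac_const p.leadingCoeff).mul (h1 p.roots)).congr fun z _ => ?_
  conv_lhs => rw [(IsAlgClosed.splits p).eq_prod_roots]
  rw [Polynomial.eval_mul, Polynomial.eval_C, Polynomial.eval_multiset_prod, Multiset.map_map]
  simp

lemma coeff_unique {u v : ℕ → ℂ} (hu : Summable fun n => ‖u n‖) (hv : Summable fun n => ‖v n‖)
    (h : ∀ η : ℂ, ‖η‖ = 1 → ∑' n, u n * η ^ n = ∑' n, v n * η ^ n) : u = v := by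
  funext j
  have h1 := coeff_shift hu 0 j
  have h2 := coeff_shift hv 0 j
  simp only [Nat.zero_le, if_true, Nat.sub_zero] at h1 h2
  rw [← h1, ← h2]
  exact integral_congr_ae (ae_norm.mono fun η hη => by simp only [h η hη])

/-- Bessel's inequality for functions of the disc algebra. -/
lemma bessel {a : ℂ → ℂ} (ha : DiffContOnCl ℂ a (Metric.ball 0 1)) (K : ℕ) :
    ∑ n ∈ Finset.range K, ‖taylorCoeff a n‖ ^ 2 ≤ ∫ ζ, ‖a ζ‖ ^ 2 ∂circleMeasure := by
  have hcont : ContinuousOn a (Metric.closedBall 0 1) := by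
    have := ha.continuousOn; rwa [closure_ball _ one_ne_zero] at this
  obtain ⟨C, hC⟩ := (isCompact_closedBall (0 : ℂ) 1).exists_bound_of_continuousOn hcont
  have hser : ∀ r ∈ Ioo (0 : ℝ) 1, ∀ ζ : ℂ, ‖ζ‖ = 1 →
      a (r * ζ) = ∑' n, (taylorCoeff a n * (r : ℂ) ^ n) * ζ ^ n := by
    intro r hr ζ hζ
    rw [← (taylor_hasSum ha.differentiableOn (z := r * ζ)
      (by simp [hζ, abs_of_pos hr.1, hr.2])).tsum_eq]
    exact tsum_congr fun n => by rw [mul_pow]; ring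
  have hs : ∀ r ∈ Ioo (0 : ℝ) 1, Summable fun n => ‖taylorCoeff a n * (r : ℂ) ^ n‖ := by
    intro r hr
    exact taylor_summable ha.differentiableOn (z := r) (by simp [abs_of_pos hr.1, hr.2])
  have h1 : ∀ r ∈ Ioo (0 : ℝ) 1, ∑ n ∈ Finset.range K, ‖taylorCoeff a n * (r : ℂ) ^ n‖ ^ 2
      ≤ ∫ ζ, ‖∑' n, (taylorCoeff a n * (r : ℂ) ^ n) * ζ ^ n‖ ^ 2 ∂circleMeasure := by
    intro r hr
    have hp := parseval (hs r hr)
    rw [← hp.tsum_eq]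
    exact hp.summable.sum_le_tsum _ fun n _ => by positivity
  have t1 : Tendsto (fun r : ℝ => ∑ n ∈ Finset.range K, ‖taylorCoeff a n * (r : ℂ) ^ n‖ ^ 2)
      (𝓝[<] 1) (𝓝 (∑ n ∈ Finset.range K, ‖taylorCoeff a n‖ ^ 2)) := by
    have : Continuous (fun r : ℝ => ∑ n ∈ Finset.range K, ‖taylorCoeff a n * (r : ℂ) ^ n‖ ^ 2) := by
      fun_prop
    have h := this.tendsto 1
    simp only [Complex.ofReal_one, one_pow, mul_one] at h
    exact h.mono_left nhdsWithin_le_nhds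
  have t2 : Tendsto (fun r : ℝ => ∫ ζ, ‖∑' n, (taylorCoeff a n * (r : ℂ) ^ n) * ζ ^ n‖ ^ 2
      ∂circleMeasure) (𝓝[<] 1) (𝓝 (∫ ζ, ‖a ζ‖ ^ 2 ∂circleMeasure)) := by
    refine tendsto_integral_filter_of_dominated_convergence (fun _ => C ^ 2) ?_ ?_ ?_ ?_
    · exact Eventually.of_forall fun r =>
        ((measurable_series _).norm.pow_const 2).aestronglyMeasurable
    · filter_upwards [Ioo_mem_nhdsLT (show (0 : ℝ) < 1 by norm_num)] with r hr
      refine ae_norm.mono fun ζ hζ => ?_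
      rw [norm_pow, norm_norm, ← hser r hr ζ hζ]
      exact pow_le_pow_left₀ (norm_nonneg _)
        (hC _ (by simp [hζ, abs_of_pos hr.1, hr.2.le])) 2
    · exact integrable_const _
    · refine ae_norm.mono fun ζ hζ => ?_
      have h1 : ContinuousWithinAt a (Metric.closedBall 0 1) ζ := hcont ζ (by simp [hζ])
      have h2 : Tendsto (fun r : ℝ => (r : ℂ) * ζ) (𝓝[<] 1) (𝓝[Metric.closedBall 0 1] ζ) := by
        refine tendsto_nhdsWithin_iff.2 ⟨?_, ?_⟩
        · have : Tendsto (fun r : ℝ => (r : ℂ) * ζ) (𝓝 1) (𝓝 (((1 : ℝ) : ℂ) * ζ)) :=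
            Continuous.tendsto (by fun_prop) _
          simp only [Complex.ofReal_one, one_mul] at this
          exact this.mono_left nhdsWithin_le_nhds
        · filter_upwards [Ioo_mem_nhdsLT (show (0 : ℝ) < 1 by norm_num)] with r hr
          simp [hζ, abs_of_pos hr.1, hr.2.le]
      refine (((h1.tendsto.comp h2).norm).pow 2).congr' ?_
      filter_upwards [Ioo_mem_nhdsLT (show (0 : ℝ) < 1 by norm_num)] with r hr
      rw [← hser r hr ζ hζ]; rfl
  refine le_of_tendsto_of_tendsto t1 t2 ?_
  filter_upwards [Ioo_mem_nhdsLT (show (0 : ℝ) < 1 by norm_num)] with r hr using h1 r hr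

/-- Cauchy product of coefficients -/
noncomputable def cprod (A B : ℕ → ℂ) (k : ℕ) : ℂ :=
  ∑ p ∈ Finset.HasAntidiagonal.antidiagonal k, A p.1 * B p.2

lemma cprod_tsum {A B : ℕ → ℂ} (hA : Summable fun n => ‖A n‖) (hB : Summable fun n => ‖B n‖)
    (z : ℂ) (hz : ‖z‖ ≤ 1) :
    (∑' n, A n * z ^ n) * (∑' n, B n * z ^ n) = ∑' n, cprod A B n * z ^ n := by
  rw [tsum_mul_tsum_eq_tsum_sum_antidiagonal_of_summable_norm (summable_series hA hz)
    (summable_series hB hz)]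
  refine tsum_congr fun k => ?_
  rw [cprod, Finset.sum_mul]
  refine Finset.sum_congr rfl fun p hp => ?_
  rw [← Finset.HasAntidiagonal.mem_antidiagonal.1 hp, pow_add]; ring

lemma cprod_scale (A B : ℕ → ℂ) (r : ℂ) (k : ℕ) :
    cprod (fun n => A n * r ^ n) (fun n => B n * r ^ n) k = cprod A B k * r ^ k := by
  rw [cprod, cprod, Finset.sum_mul]
  refine Finset.sum_congr rfl fun p hp => ?_
  rw [← Finset.HasAntidiagonal.mem_antidiagonal.1 hp, pow_add]; ring

lemma summable_cprod {A B : ℕ → ℂ} (hA : Summable fun n => ‖A n‖) (hB : Summable fun n => ‖B n‖) :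
    Summable fun n => ‖cprod A B n‖ :=
  summable_norm_sum_mul_antidiagonal_of_summable_norm hA hB

/-- Factorization of polynomial coefficient sequences with `ℓ²` control. -/
lemma poly_coeff_fac (p : Polynomial ℂ) : ∃ A B : ℕ → ℂ,
    (∀ K, ∑ n ∈ Finset.range K, ‖A n‖ ^ 2 ≤ ∫ ζ, ‖p.eval ζ‖ ∂circleMeasure) ∧
    (∀ K, ∑ n ∈ Finset.range K, ‖B n‖ ^ 2 ≤ ∫ ζ, ‖p.eval ζ‖ ∂circleMeasure) ∧
    ∀ k, cprod A B k = p.coeff k := by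
  obtain ⟨a, b, ha, hb, h1, h2⟩ := fac_poly p
  refine ⟨taylorCoeff a, taylorCoeff b, fun K => ?_, fun K => ?_, ?_⟩
  · refine (bessel ha K).trans_eq (integral_congr_ae (ae_norm.mono fun ζ hζ => ?_))
    simp only [h1 ζ hζ.le, norm_mul, h2 ζ hζ, sq]
  · refine (bessel hb K).trans_eq (integral_congr_ae (ae_norm.mono fun ζ hζ => ?_))
    simp only [h1 ζ hζ.le, norm_mul, h2 ζ hζ, sq]
  · have hhalf : ‖(1 / 2 : ℂ)‖ < 1 := by norm_num
    have sA := taylor_summable ha.differentiableOn hhalf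
    have sB := taylor_summable hb.differentiableOn hhalf
    have hz0 : ∀ k, k ∉ Finset.range (p.natDegree + 1) → p.coeff k = 0 := fun k hk =>
      Polynomial.coeff_eq_zero_of_natDegree_lt (by simpa using hk)
    have sp : Summable fun n => ‖p.coeff n * (1 / 2 : ℂ) ^ n‖ :=
      summable_of_ne_finset_zero (s := Finset.range (p.natDegree + 1)) fun k hk => by
        rw [hz0 k hk]; simp
    have := coeff_unique (summable_cprod sA sB) sp (by
      intro η hη
      rw [← cprod_tsum sA sB η hη.le]
      have e : ∀ c : ℕ → ℂ, (∑' n, c n * (1 / 2 : ℂ) ^ n * η ^ n) = ∑' n, c n * (1 / 2 * η) ^ n :=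
        fun c => tsum_congr fun n => by rw [mul_pow]; ring
      have hz : ‖1 / 2 * η‖ < 1 := by rw [norm_mul, hη, mul_one]; exact hhalf
      rw [e, e, e, (taylor_hasSum ha.differentiableOn hz).tsum_eq,
        (taylor_hasSum hb.differentiableOn hz).tsum_eq, ← h1 _ hz.le,
        tsum_eq_sum (s := Finset.range (p.natDegree + 1)) (fun k hk => by rw [hz0 k hk]; simp)]
      exact Polynomial.eval_eq_sum_range _)
    intro k
    have hk := congrFun this k
    rw [cprod_scale] at hk
    exact mul_right_cancel₀ (pow_ne_zero _ (by norm_num)) hk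


/-- radii tending to one -/
lemma exists_radii : ∃ ρ : ℕ → ℝ, (∀ m, ρ m ∈ Ioo (0 : ℝ) 1) ∧ Tendsto ρ atTop (𝓝[<] 1) := by
  refine ⟨fun m => 1 - 1 / ((m : ℝ) + 2), ?_, ?_⟩
  · intro m
    have h0 : (0 : ℝ) < 1 / ((m : ℝ) + 2) := by positivity
    have h1 : 1 / ((m : ℝ) + 2) < 1 := by
      rw [div_lt_one (by positivity)]; linarith [Nat.cast_nonneg (α := ℝ) m]
    constructor <;> linarith
  · refine tendsto_nhdsWithin_iff.2 ⟨?_, Eventually.of_forall fun m => ?_⟩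
    · have : Tendsto (fun m : ℕ => 1 / ((m : ℝ) + 2)) atTop (𝓝 0) := by
        have h2 : Tendsto (fun m : ℕ => (m : ℝ) + 2) atTop atTop :=
          tendsto_atTop_add_const_right _ _ tendsto_natCast_atTop_atTop
        simp only [one_div]
        exact tendsto_inv_atTop_zero.comp h2
      simpa using this.const_sub 1
    · have h0 : (0 : ℝ) < 1 / ((m : ℝ) + 2) := by positivity
      simp only [mem_Iio]; linarith

section hOne
variable {h : ℂ → ℂ}

lemma h_series
    (hh : DifferentiableOn ℂ h (Metric.ball (0 : ℂ) 1)) {r : ℝ} (hr : r ∈ Ioo (0 : ℝ) 1) {ζ : ℂ} (hζ : ‖ζ‖ = 1) :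
    h (r * ζ) = ∑' n, (taylorCoeff h n * (r : ℂ) ^ n) * ζ ^ n := by
  rw [← (taylor_hasSum hh (z := r * ζ) (by simp [hζ, abs_of_pos hr.1, hr.2])).tsum_eq]
  exact tsum_congr fun n => by rw [mul_pow]; ring

lemma h_summable
    (hh : DifferentiableOn ℂ h (Metric.ball (0 : ℂ) 1)) {r : ℝ} (hr : r ∈ Ioo (0 : ℝ) 1) :
    Summable fun n => ‖taylorCoeff h n * (r : ℂ) ^ n‖ :=
  taylor_summable hh (z := r) (by simp [abs_of_pos hr.1, hr.2])

lemma h_bound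
    (hh : DifferentiableOn ℂ h (Metric.ball (0 : ℂ) 1)) (hb : hardyNorm 1 h ≠ ⊤) {r : ℝ} (hr : r ∈ Ioo (0 : ℝ) 1) :
    ∫ ζ, ‖∑' n, (taylorCoeff h n * (r : ℂ) ^ n) * ζ ^ n‖ ∂circleMeasure
      ≤ (hardyNorm 1 h).toReal := by
  have h1 : ∫⁻ ζ, ENNReal.ofReal (‖h (↑r * ζ)‖ ^ (1 : ℝ)) ∂circleMeasure ≤ hardyNorm 1 h :=
    le_iSup₂ (f := fun (r : ℝ) (_ : r ∈ Ioo (0 : ℝ) 1) =>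
      ∫⁻ ζ, ENNReal.ofReal (‖h (↑r * ζ)‖ ^ (1 : ℝ)) ∂circleMeasure) r hr
  rw [integral_eq_lintegral_of_nonneg_ae (Eventually.of_forall fun _ => norm_nonneg _)
    (measurable_series _).norm.aestronglyMeasurable]
  refine ENNReal.toReal_mono hb (le_trans (le_of_eq ?_) h1)
  refine lintegral_congr_ae (ae_norm.mono fun ζ hζ => ?_)
  simp only [h_series hh hr hζ, Real.rpow_one]

/-- approximate factorization -/
lemma approx_fac
    (hh : DifferentiableOn ℂ h (Metric.ball (0 : ℂ) 1)) (hb : hardyNorm 1 h ≠ ⊤) {r : ℝ} (hr : r ∈ Ioo (0 : ℝ) 1) (m : ℕ) :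
    ∃ A B : ℕ → ℂ,
    (∀ K, ∑ n ∈ Finset.range K, ‖A n‖ ^ 2 ≤ (hardyNorm 1 h).toReal + 1) ∧
    (∀ K, ∑ n ∈ Finset.range K, ‖B n‖ ^ 2 ≤ (hardyNorm 1 h).toReal + 1) ∧
    ∀ k < m, cprod A B k = taylorCoeff h k * (r : ℂ) ^ k := by
  set c : ℕ → ℂ := fun n => taylorCoeff h n * (r : ℂ) ^ n with hc
  have hs : Summable fun n => ‖c n‖ := h_summable hh hr
  obtain ⟨N, hmN, hN⟩ : ∃ N, m ≤ N ∧ ∑' k, ‖c (k + N)‖ ≤ 1 := by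
    have := tendsto_sum_nat_add (fun n => ‖c n‖)
    have h2 := this.eventually (ge_mem_nhds (show (0 : ℝ) < 1 by norm_num))
    obtain ⟨N, h3, h4⟩ := (h2.and (eventually_ge_atTop m)).exists
    exact ⟨N, h4, h3⟩
  set p : Polynomial ℂ := ∑ k ∈ Finset.range N, Polynomial.monomial k (c k) with hp
  have hpe : ∀ ζ, p.eval ζ = ∑ k ∈ Finset.range N, c k * ζ ^ k := by
    intro ζ; rw [hp, Polynomial.eval_finsetSum]; simp
  have hpc : ∀ k < N, p.coeff k = c k := by
    intro k hk
    rw [hp, Polynomial.finsetSum_coeff]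
    simp only [Polynomial.coeff_monomial]
    rw [Finset.sum_ite_eq' ]
    simp [hk]
  obtain ⟨A, B, hA, hB, hAB⟩ := poly_coeff_fac p
  have hpi : ∫ ζ, ‖p.eval ζ‖ ∂circleMeasure ≤ (hardyNorm 1 h).toReal + 1 := by
    have hi := integrable_series hs
    have h3 : ∫ ζ, ‖p.eval ζ‖ ∂circleMeasure
        ≤ ∫ ζ, (‖∑' n, c n * ζ ^ n‖ + 1) ∂circleMeasure := by
      refine integral_mono_of_nonneg (Eventually.of_forall fun _ => norm_nonneg _)
        (hi.norm.add (integrable_const _)) (ae_norm.mono fun ζ hζ => ?_)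
      have hsz := summable_series hs hζ.le
      have h4 := hsz.of_norm.sum_add_tsum_nat_add N
      have h5 : p.eval ζ = (∑' n, c n * ζ ^ n) - ∑' n, c (n + N) * ζ ^ (n + N) := by
        rw [← h4, hpe]; ring
      have h6 : ‖∑' n, c (n + N) * ζ ^ (n + N)‖ ≤ 1 := by
        refine le_trans ?_ hN
        have h7 : ∀ n, ‖c (n + N) * ζ ^ (n + N)‖ = ‖c (n + N)‖ := fun n => by simp [hζ]
        refine (norm_tsum_le_tsum_norm ?_).trans_eq (tsum_congr h7)
        simp_rw [h7]; exact (summable_nat_add_iff N).2 hs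
      simp only [h5]
      exact (norm_sub_le _ _).trans (by linarith)
    rw [integral_add hi.norm (integrable_const _)] at h3
    have := h_bound hh hb hr
    simp only [integral_const, probReal_univ, one_smul] at h3
    linarith
  exact ⟨A, B, fun K => (hA K).trans hpi, fun K => (hB K).trans hpi, fun k hk => by
    rw [hAB, hpc k (by omega)]⟩

lemma ultra_limit {C : ℝ} {A : ℕ → ℕ → ℂ}
    (hA : ∀ m K, ∑ n ∈ Finset.range K, ‖A m n‖ ^ 2 ≤ C) :
    ∃ L : ℕ → ℂ, (∀ n, Tendsto (fun m => A m n) (hyperfilter ℕ : Filter ℕ) (𝓝 (L n))) ∧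
      ∀ K, ∑ n ∈ Finset.range K, ‖L n‖ ^ 2 ≤ C := by
  have h1 : ∀ n m, ‖A m n‖ ≤ Real.sqrt C := by
    intro n m
    refine Real.le_sqrt_of_sq_le (le_trans ?_ (hA m (n + 1)))
    exact Finset.single_le_sum (f := fun n => ‖A m n‖ ^ 2) (fun i _ => by positivity)
      (Finset.mem_range.2 (Nat.lt_succ_self n))
  have h2 : ∀ n, ∃ L, Tendsto (fun m => A m n) (hyperfilter ℕ : Filter ℕ) (𝓝 L) := by
    intro n
    obtain ⟨L, _, hL⟩ := (isCompact_closedBall (0 : ℂ) (Real.sqrt C)).ultrafilter_le_nhds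
      ((hyperfilter ℕ).map fun m => A m n) (by
        rw [Ultrafilter.coe_map, le_principal_iff, mem_map]
        exact univ_mem' fun m => by simpa using h1 n m)
    exact ⟨L, hL⟩
  choose L hL using h2
  refine ⟨L, hL, fun K => ?_⟩
  refine le_of_tendsto (tendsto_finsetSum _ fun n _ => ((hL n).norm.pow 2)) ?_
  exact Eventually.of_forall fun m => hA m K

/-- `H¹ = H² · H²` on the level of coefficients. -/
lemma exact_fac
    (hh : DifferentiableOn ℂ h (Metric.ball (0 : ℂ) 1)) (hb : hardyNorm 1 h ≠ ⊤) : ∃ A B : ℕ → ℂ,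
    (Summable fun n => ‖A n‖ ^ 2) ∧ (Summable fun n => ‖B n‖ ^ 2) ∧
    ∀ k, cprod A B k = taylorCoeff h k := by
  obtain ⟨ρ, hρm, ht⟩ := exists_radii
  have hρt : Tendsto ρ atTop (𝓝 1) := ht.mono_right nhdsWithin_le_nhds
  have hex := fun m => approx_fac hh hb (hρm m) m
  choose A B hA hB hAB using hex
  obtain ⟨A', tA, sA⟩ := ultra_limit hA
  obtain ⟨B', tB, sB⟩ := ultra_limit hB
  refine ⟨A', B', summable_of_sum_range_le (fun n => by positivity) sA,
    summable_of_sum_range_le (fun n => by positivity) sB, fun k => ?_⟩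
  have hU : (hyperfilter ℕ : Filter ℕ) ≤ atTop := Nat.hyperfilter_le_atTop
  have t1 : Tendsto (fun m => cprod (A m) (B m) k) (hyperfilter ℕ : Filter ℕ)
      (𝓝 (cprod A' B' k)) := tendsto_finsetSum _ fun p _ => (tA p.1).mul (tB p.2)
  have t2 : Tendsto (fun m => taylorCoeff h k * (ρ m : ℂ) ^ k) (hyperfilter ℕ : Filter ℕ)
      (𝓝 (taylorCoeff h k)) := by
    have : Tendsto (fun m => taylorCoeff h k * (ρ m : ℂ) ^ k) atTop
        (𝓝 (taylorCoeff h k * ((1 : ℝ) : ℂ) ^ k)) :=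
      (((Complex.continuous_ofReal.tendsto 1).comp hρt).pow k).const_mul _
    simp only [Complex.ofReal_one, one_pow, mul_one] at this
    exact this.mono_left hU
  refine tendsto_nhds_unique t1 (t2.congr' ?_)
  filter_upwards [hU (eventually_gt_atTop k)] with m hm
  rw [hAB m k hm]

end hOne

lemma summable_scale {A : ℕ → ℂ} (hA : Summable fun n => ‖A n‖ ^ 2) {r : ℝ}
    (hr : r ∈ Ioo (0 : ℝ) 1) : Summable fun n => ‖A n * (r : ℂ) ^ n‖ := by
  have hg : Summable fun n : ℕ => (r ^ 2) ^ n :=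
    summable_geometric_of_lt_one (by positivity) (by nlinarith [hr.1, hr.2])
  refine Summable.of_nonneg_of_le (fun _ => norm_nonneg _) (fun n => ?_) (hA.add hg)
  rw [norm_mul, norm_pow, Complex.norm_real, Real.norm_of_nonneg hr.1.le, ← pow_mul, mul_comm 2 n,
    pow_mul]
  nlinarith [sq_nonneg (‖A n‖ - r ^ n), sq_nonneg ‖A n‖, sq_nonneg (r ^ n)]

/-- the tail functional -/
noncomputable def psi (A : ℕ → ℂ) (s : ℝ) : ℝ := ∑' n, ‖A n‖ ^ 2 * (1 - s ^ n) ^ 2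

lemma psi_bound {s : ℝ} (hs : s ∈ Ioo (0 : ℝ) 1) (n : ℕ) : (1 - s ^ n) ^ 2 ≤ 1 := by
  have h1 : s ^ n ≤ 1 := pow_le_one₀ hs.1.le hs.2.le
  have h2 : 0 ≤ s ^ n := pow_nonneg hs.1.le n
  nlinarith

lemma psi_tendsto {A : ℕ → ℂ} (hA : Summable fun n => ‖A n‖ ^ 2) :
    Tendsto (psi A) (𝓝[<] 1) (𝓝 0) := by
  have : Tendsto (psi A) (𝓝[<] 1) (𝓝 (∑' n, ‖A n‖ ^ 2 * (1 - (1 : ℝ) ^ n) ^ 2)) := by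
    refine tendsto_tsum_of_dominated_convergence hA (fun n => ?_) ?_
    · have : Continuous fun s : ℝ => ‖A n‖ ^ 2 * (1 - s ^ n) ^ 2 := by fun_prop
      exact (this.tendsto 1).mono_left nhdsWithin_le_nhds
    · filter_upwards [Ioo_mem_nhdsLT (show (0 : ℝ) < 1 by norm_num)] with s hs n
      rw [Real.norm_of_nonneg (by positivity)]
      exact mul_le_of_le_one_right (by positivity) (psi_bound hs n)
  simpa using this

lemma l2_diff {A : ℕ → ℂ} (hA : Summable fun n => ‖A n‖ ^ 2) {r s : ℝ}
    (hs : s ∈ Ioo (0 : ℝ) 1) (hr : r ∈ Ioo (0 : ℝ) 1) (hsr : s ≤ r) :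
    ∫ ζ, ‖(∑' n, (A n * (r : ℂ) ^ n) * ζ ^ n) - ∑' n, (A n * (s : ℂ) ^ n) * ζ ^ n‖ ^ 2
      ∂circleMeasure ≤ psi A s := by
  have sr := summable_scale hA hr
  have ss := summable_scale hA hs
  have sd : Summable fun n => ‖A n * (r : ℂ) ^ n - A n * (s : ℂ) ^ n‖ :=
    Summable.of_nonneg_of_le (fun _ => norm_nonneg _) (fun n => norm_sub_le _ _) (sr.add ss)
  have e : ∀ᵐ ζ ∂circleMeasure,
      ‖(∑' n, (A n * (r : ℂ) ^ n) * ζ ^ n) - ∑' n, (A n * (s : ℂ) ^ n) * ζ ^ n‖ ^ 2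
      = ‖∑' n, (A n * (r : ℂ) ^ n - A n * (s : ℂ) ^ n) * ζ ^ n‖ ^ 2 := by
    refine ae_norm.mono fun ζ hζ => ?_
    rw [← (summable_series sr hζ.le).of_norm.tsum_sub (summable_series ss hζ.le).of_norm]
    simp_rw [sub_mul]
  rw [integral_congr_ae e, ← (parseval sd).tsum_eq, psi]
  refine (parseval sd).summable.tsum_le_tsum (fun n => ?_) ?_
  · rw [← mul_sub, norm_mul, mul_pow]
    refine mul_le_mul_of_nonneg_left ?_ (by positivity)
    rw [← Complex.ofReal_pow, ← Complex.ofReal_pow, ← Complex.ofReal_sub, Complex.norm_real,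
      Real.norm_of_nonneg (sub_nonneg.2 (pow_le_pow_left₀ hs.1.le hsr n))]
    refine pow_le_pow_left₀ (sub_nonneg.2 (pow_le_pow_left₀ hs.1.le hsr n)) ?_ 2
    linarith [pow_le_one₀ (n := n) hr.1.le hr.2.le]
  · refine Summable.of_nonneg_of_le (fun n => by positivity) (fun n => ?_) hA
    exact mul_le_of_le_one_right (by positivity) (psi_bound hs n)

lemma l2_norm {A : ℕ → ℂ} (hA : Summable fun n => ‖A n‖ ^ 2) {r : ℝ} (hr : r ∈ Ioo (0 : ℝ) 1) :
    ∫ ζ, ‖∑' n, (A n * (r : ℂ) ^ n) * ζ ^ n‖ ^ 2 ∂circleMeasure ≤ ∑' n, ‖A n‖ ^ 2 := by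
  have sr := summable_scale hA hr
  rw [← (parseval sr).tsum_eq]
  refine (parseval sr).summable.tsum_le_tsum (fun n => ?_) hA
  refine pow_le_pow_left₀ (norm_nonneg _) ?_ 2
  rw [norm_mul, norm_pow, Complex.norm_real, Real.norm_of_nonneg hr.1.le]
  exact mul_le_of_le_one_right (norm_nonneg _) (pow_le_one₀ hr.1.le hr.2.le)

lemma amgm {t : ℝ} (ht : 0 < t) (x y : ℝ) : x * y ≤ t * x ^ 2 + t⁻¹ * y ^ 2 := by
  have h1 : t⁻¹ * y ^ 2 = t * (t⁻¹ * y) ^ 2 := by field_simp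
  have h2 : x * y = t * (x * (t⁻¹ * y)) := by field_simp
  rw [h1, h2, ← mul_add]
  refine mul_le_mul_of_nonneg_left ?_ ht.le
  nlinarith [sq_nonneg (x - t⁻¹ * y), sq_nonneg x, sq_nonneg (t⁻¹ * y)]

lemma l1_diff {A B : ℕ → ℂ} (hA : Summable fun n => ‖A n‖ ^ 2) (hB : Summable fun n => ‖B n‖ ^ 2)
    {r s t : ℝ} (hs : s ∈ Ioo (0 : ℝ) 1) (hr : r ∈ Ioo (0 : ℝ) 1) (hsr : s ≤ r) (ht : 0 < t) :
    ∫ ζ, ‖(∑' n, (cprod A B n * (r : ℂ) ^ n) * ζ ^ n)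
        - ∑' n, (cprod A B n * (s : ℂ) ^ n) * ζ ^ n‖ ∂circleMeasure
      ≤ t * (psi A s + psi B s) + t⁻¹ * (∑' n, ‖A n‖ ^ 2 + ∑' n, ‖B n‖ ^ 2) := by
  have sAr := summable_scale hA hr
  have sAs := summable_scale hA hs
  have sBr := summable_scale hB hr
  have sBs := summable_scale hB hs
  set FA : ℝ → ℂ → ℂ := fun r ζ => ∑' n, (A n * (r : ℂ) ^ n) * ζ ^ n with hFA
  set FB : ℝ → ℂ → ℂ := fun r ζ => ∑' n, (B n * (r : ℂ) ^ n) * ζ ^ n with hFB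
  have mA : ∀ r, Measurable (FA r) := fun r => measurable_series _
  have mB : ∀ r, Measurable (FB r) := fun r => measurable_series _
  have bA : ∀ {r}, r ∈ Ioo (0 : ℝ) 1 → ∀ ζ : ℂ, ‖ζ‖ = 1 →
      ‖FA r ζ‖ ≤ ∑' n, ‖A n * (r : ℂ) ^ n‖ := fun hr ζ hζ =>
    norm_series_le (summable_scale hA hr) hζ.le
  have bB : ∀ {r}, r ∈ Ioo (0 : ℝ) 1 → ∀ ζ : ℂ, ‖ζ‖ = 1 →
      ‖FB r ζ‖ ≤ ∑' n, ‖B n * (r : ℂ) ^ n‖ := fun hr ζ hζ =>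
    norm_series_le (summable_scale hB hr) hζ.le
  have i1 : Integrable (fun ζ => ‖FA r ζ - FA s ζ‖ ^ 2) circleMeasure :=
    Integrable.of_bound (((mA r).sub (mA s)).norm.pow_const 2).aestronglyMeasurable
      ((∑' n, ‖A n * (r : ℂ) ^ n‖ + ∑' n, ‖A n * (s : ℂ) ^ n‖) ^ 2) (ae_norm.mono fun ζ hζ => by
        rw [norm_pow, norm_norm]
        exact pow_le_pow_left₀ (norm_nonneg _)
          ((norm_sub_le _ _).trans (add_le_add (bA hr ζ hζ) (bA hs ζ hζ))) 2)
  have i2 : Integrable (fun ζ => ‖FB r ζ - FB s ζ‖ ^ 2) circleMeasure :=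
    Integrable.of_bound (((mB r).sub (mB s)).norm.pow_const 2).aestronglyMeasurable
      ((∑' n, ‖B n * (r : ℂ) ^ n‖ + ∑' n, ‖B n * (s : ℂ) ^ n‖) ^ 2) (ae_norm.mono fun ζ hζ => by
        rw [norm_pow, norm_norm]
        exact pow_le_pow_left₀ (norm_nonneg _)
          ((norm_sub_le _ _).trans (add_le_add (bB hr ζ hζ) (bB hs ζ hζ))) 2)
  have i3 : Integrable (fun ζ => ‖FA s ζ‖ ^ 2) circleMeasure :=
    Integrable.of_bound ((mA s).norm.pow_const 2).aestronglyMeasurable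
      ((∑' n, ‖A n * (s : ℂ) ^ n‖) ^ 2) (ae_norm.mono fun ζ hζ => by
        rw [norm_pow, norm_norm]; exact pow_le_pow_left₀ (norm_nonneg _) (bA hs ζ hζ) 2)
  have i4 : Integrable (fun ζ => ‖FB r ζ‖ ^ 2) circleMeasure :=
    Integrable.of_bound ((mB r).norm.pow_const 2).aestronglyMeasurable
      ((∑' n, ‖B n * (r : ℂ) ^ n‖) ^ 2) (ae_norm.mono fun ζ hζ => by
        rw [norm_pow, norm_norm]; exact pow_le_pow_left₀ (norm_nonneg _) (bB hr ζ hζ) 2)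
  have e : ∀ {r}, r ∈ Ioo (0 : ℝ) 1 → ∀ ζ : ℂ, ‖ζ‖ = 1 →
      ∑' n, (cprod A B n * (r : ℂ) ^ n) * ζ ^ n = FA r ζ * FB r ζ := by
    intro r hr ζ hζ
    simp only [hFA, hFB]
    rw [cprod_tsum (summable_scale hA hr) (summable_scale hB hr) ζ hζ.le]
    simp_rw [cprod_scale]
  calc _ ≤ ∫ ζ, ((t * ‖FA r ζ - FA s ζ‖ ^ 2 + t * ‖FB r ζ - FB s ζ‖ ^ 2)
        + (t⁻¹ * ‖FA s ζ‖ ^ 2 + t⁻¹ * ‖FB r ζ‖ ^ 2)) ∂circleMeasure := by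
        refine integral_mono_of_nonneg (Eventually.of_forall fun _ => norm_nonneg _)
          (((i1.const_mul t).add (i2.const_mul t)).add ((i3.const_mul t⁻¹).add (i4.const_mul t⁻¹)))
          (ae_norm.mono fun ζ hζ => ?_)
        simp only [e hr ζ hζ, e hs ζ hζ]
        have h1 : FA r ζ * FB r ζ - FA s ζ * FB s ζ
          = (FA r ζ - FA s ζ) * FB r ζ + (FB r ζ - FB s ζ) * FA s ζ := by ring
        rw [h1]
        refine (norm_add_le _ _).trans ?_
        rw [norm_mul, norm_mul]
        linarith [amgm ht ‖FA r ζ - FA s ζ‖ ‖FB r ζ‖, amgm ht ‖FB r ζ - FB s ζ‖ ‖FA s ζ‖]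
    _ = t * ((∫ ζ, ‖FA r ζ - FA s ζ‖ ^ 2 ∂circleMeasure)
          + ∫ ζ, ‖FB r ζ - FB s ζ‖ ^ 2 ∂circleMeasure)
        + t⁻¹ * ((∫ ζ, ‖FA s ζ‖ ^ 2 ∂circleMeasure) + ∫ ζ, ‖FB r ζ‖ ^ 2 ∂circleMeasure) := by
        have i12 : Integrable (fun ζ => t * ‖FA r ζ - FA s ζ‖ ^ 2 + t * ‖FB r ζ - FB s ζ‖ ^ 2)
          circleMeasure := (i1.const_mul t).add (i2.const_mul t)
        have i34 : Integrable (fun ζ => t⁻¹ * ‖FA s ζ‖ ^ 2 + t⁻¹ * ‖FB r ζ‖ ^ 2)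
          circleMeasure := (i3.const_mul t⁻¹).add (i4.const_mul t⁻¹)
        rw [integral_add i12 i34,
          integral_add (i1.const_mul t) (i2.const_mul t),
          integral_add (i3.const_mul t⁻¹) (i4.const_mul t⁻¹)]
        simp_rw [integral_const_mul]
        ring
    _ ≤ _ := by
        have := l2_diff hA hs hr hsr
        have := l2_diff hB hs hr hsr
        have := l2_norm hA hs
        have := l2_norm hB hr
        gcongr

section vanish
variable {h hs : ℂ → ℂ}

lemma ae_limit
    (hh : DifferentiableOn ℂ h (Metric.ball (0 : ℂ) 1))
    (hbd : IsBoundaryFn h hs) {ρ : ℕ → ℝ} (hρ : ∀ m, ρ m ∈ Ioo (0 : ℝ) 1) (ht : Tendsto ρ atTop (𝓝[<] 1)) :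
    ∀ᵐ ζ ∂circleMeasure,
      Tendsto (fun m => ∑' n, (taylorCoeff h n * (ρ m : ℂ) ^ n) * ζ ^ n) atTop (𝓝 (hs ζ)) := by
  filter_upwards [hbd, ae_norm] with ζ h1 hζ
  exact (h1.comp ht).congr fun m => h_series hh (hρ m) hζ

lemma boundary_norm_le
    (hh : DifferentiableOn ℂ h (Metric.ball (0 : ℂ) 1))
    (hbd : IsBoundaryFn h hs) : ∫⁻ ζ, ‖hs ζ‖ₑ ∂circleMeasure ≤ hardyNorm 1 h := by
  obtain ⟨ρ, hρ, ht⟩ := exists_radii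
  have h1 := ae_limit hh hbd hρ ht
  calc _ = ∫⁻ ζ, liminf (fun m => ‖∑' n, (taylorCoeff h n * (ρ m : ℂ) ^ n) * ζ ^ n‖ₑ) atTop
        ∂circleMeasure := by
        refine lintegral_congr_ae (h1.mono fun ζ hζ => ?_)
        exact (hζ.enorm.liminf_eq).symm
    _ ≤ liminf (fun m => ∫⁻ ζ, ‖∑' n, (taylorCoeff h n * (ρ m : ℂ) ^ n) * ζ ^ n‖ₑ
        ∂circleMeasure) atTop :=
        lintegral_liminf_le fun m => (measurable_series _).enorm
    _ ≤ liminf (fun _ : ℕ => hardyNorm 1 h) atTop := by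
        refine liminf_le_liminf (Eventually.of_forall fun m => ?_)
        refine le_trans (le_of_eq ?_) (le_iSup₂ (f := fun (r : ℝ) (_ : r ∈ Ioo (0 : ℝ) 1) =>
          ∫⁻ ζ, ENNReal.ofReal (‖h (↑r * ζ)‖ ^ (1 : ℝ)) ∂circleMeasure) (ρ m) (hρ m))
        refine lintegral_congr_ae (ae_norm.mono fun ζ hζ => ?_)
        simp only [h_series hh (hρ m) hζ, Real.rpow_one, ofReal_norm]
    _ = _ := by simp

lemma vanish
    (hh : DifferentiableOn ℂ h (Metric.ball (0 : ℂ) 1))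
    (hb : hardyNorm 1 h ≠ ⊤)
    (hbd : IsBoundaryFn h hs)
    (hi : Integrable hs circleMeasure) {j : ℕ} (hj : 1 ≤ j) : ∫ ζ, hs ζ * ζ ^ j ∂circleMeasure = 0 := by
  obtain ⟨A, B, hA, hB, hAB⟩ := exact_fac hh hb
  obtain ⟨ρ, hρ, ht⟩ := exists_radii
  have h1 := ae_limit hh hbd hρ ht
  have hAB' : cprod A B = taylorCoeff h := funext hAB
  set H : ℝ → ℂ → ℂ := fun r ζ => ∑' n, (taylorCoeff h n * (r : ℂ) ^ n) * ζ ^ n with hH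
  have hHi : ∀ {r}, r ∈ Ioo (0 : ℝ) 1 → Integrable (H r) circleMeasure := fun hr =>
    integrable_series (h_summable hh hr)
  set E : ℝ := ∑' n, ‖A n‖ ^ 2 + ∑' n, ‖B n‖ ^ 2 with hE
  have key : ∀ s ∈ Ioo (0 : ℝ) 1, ∀ t : ℝ, 0 < t →
      ‖∫ ζ, hs ζ * ζ ^ j ∂circleMeasure‖ ≤ t * (psi A s + psi B s) + t⁻¹ * E := by
    intro s hs' t ht0
    set R := t * (psi A s + psi B s) + t⁻¹ * E with hR
    have hpsi : ∀ A : ℕ → ℂ, 0 ≤ psi A s := fun A => tsum_nonneg fun n => by positivity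
    have hR0 : 0 ≤ R := by
      have := hpsi A; have := hpsi B
      have : 0 ≤ E := add_nonneg (tsum_nonneg fun n => by positivity)
        (tsum_nonneg fun n => by positivity)
      positivity
    have hz : ∫ ζ, H s ζ * ζ ^ j ∂circleMeasure = 0 := by
      have := coeff_shift (h_summable hh hs') j 0
      rw [if_neg (by omega)] at this
      rw [← this]
      congr 1; funext ζ; simp [hH, mul_comm]
    have hIa : Integrable (fun ζ => hs ζ * ζ ^ j) circleMeasure :=
      hi.mul_bdd (c := 1) (by fun_prop) (ae_norm.mono fun ζ hζ => by simp [hζ])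
    have hIb : Integrable (fun ζ => H s ζ * ζ ^ j) circleMeasure :=
      (hHi hs').mul_bdd (c := 1) (by fun_prop) (ae_norm.mono fun ζ hζ => by simp [hζ])
    have h2 : ∫ ζ, hs ζ * ζ ^ j ∂circleMeasure
        = ∫ ζ, (hs ζ - H s ζ) * ζ ^ j ∂circleMeasure := by
      simp_rw [sub_mul]
      rw [integral_sub hIa hIb, hz, sub_zero]
    have h3 : ∫⁻ ζ, ‖hs ζ - H s ζ‖ₑ ∂circleMeasure ≤ ENNReal.ofReal R := by
      calc _ = ∫⁻ ζ, liminf (fun m => ‖H (ρ m) ζ - H s ζ‖ₑ) atTop ∂circleMeasure := by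
            refine lintegral_congr_ae (h1.mono fun ζ hζ => ?_)
            exact ((hζ.sub_const (H s ζ)).enorm.liminf_eq).symm
        _ ≤ liminf (fun m => ∫⁻ ζ, ‖H (ρ m) ζ - H s ζ‖ₑ ∂circleMeasure) atTop :=
            lintegral_liminf_le fun m => ((measurable_series _).sub (measurable_series _)).enorm
        _ ≤ liminf (fun _ : ℕ => ENNReal.ofReal R) atTop := by
            refine liminf_le_liminf ?_
            have hev : ∀ᶠ m in atTop, ρ m ∈ Ioo s 1 := ht.eventually (Ioo_mem_nhdsLT hs'.2)
            filter_upwards [hev] with m hm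
            have h4 := l1_diff hA hB hs' (hρ m) hm.1.le ht0
            rw [hAB'] at h4
            have hsub : Integrable (fun ζ => H (ρ m) ζ - H s ζ) circleMeasure :=
              (hHi (hρ m)).sub (hHi hs')
            rw [← ofReal_integral_norm_eq_lintegral_enorm hsub]
            exact ENNReal.ofReal_le_ofReal h4
        _ = _ := by simp
    rw [h2]
    refine (norm_integral_le_lintegral_norm _).trans ?_
    refine ENNReal.toReal_le_of_le_ofReal hR0 (le_trans (le_of_eq ?_) h3)
    refine lintegral_congr_ae (ae_norm.mono fun ζ hζ => ?_)
    simp [hζ, ofReal_norm]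
  have key2 : ∀ t : ℝ, 0 < t → ‖∫ ζ, hs ζ * ζ ^ j ∂circleMeasure‖ ≤ t⁻¹ * E := by
    intro t ht0
    have t1 : Tendsto (fun s => t * (psi A s + psi B s) + t⁻¹ * E) (𝓝[<] 1) (𝓝 (t⁻¹ * E)) := by
      have := (((psi_tendsto hA).add (psi_tendsto hB)).const_mul t).add_const (t⁻¹ * E)
      simpa using this
    refine ge_of_tendsto t1 ?_
    filter_upwards [Ioo_mem_nhdsLT (show (0 : ℝ) < 1 by norm_num)] with s hs' using key s hs' t ht0
  have t2 : Tendsto (fun t : ℝ => t⁻¹ * E) atTop (𝓝 0) := by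
    simpa using tendsto_inv_atTop_zero.mul_const E
  have := ge_of_tendsto t2 ((eventually_gt_atTop 0).mono key2)
  exact norm_le_zero_iff.1 this

end vanish


/-! ### Kernel estimates -/

lemma u_moment {f hs : ℂ → ℂ} (hi : Integrable hs circleMeasure)
    (hv : ∀ j : ℕ, 1 ≤ j → ∫ ζ, hs ζ * ζ ^ j ∂circleMeasure = 0) (n : ℕ) {j : ℕ}
    (hj : n + 1 ≤ j) :
    ∫ ζ, (starRingEnd ℂ (cesaro f n ζ) * hs ζ) * ζ ^ j ∂circleMeasure = 0 := by
  have hIm : ∀ m : ℕ, Integrable (fun ζ => hs ζ * ζ ^ m) circleMeasure := fun m =>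
    hi.mul_bdd (c := 1) (by fun_prop) (ae_norm.mono fun ζ hζ => by simp [hζ])
  have e : ∀ᵐ ζ ∂circleMeasure, (starRingEnd ℂ (cesaro f n ζ) * hs ζ) * ζ ^ j
      = starRingEnd ℂ ((n : ℂ) + 1)⁻¹ * ∑ k ∈ Finset.range (n + 1), ∑ i ∈ Finset.range (k + 1),
        starRingEnd ℂ (taylorCoeff f i) * (hs ζ * ζ ^ (j - i)) := by
    refine ae_norm.mono fun ζ hζ => ?_
    simp only [cesaro, taylorPartial]
    rw [map_mul, mul_assoc, mul_assoc, map_sum, Finset.sum_mul]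
    congr 1
    refine Finset.sum_congr rfl fun k hk => ?_
    rw [map_sum, Finset.sum_mul]
    refine Finset.sum_congr rfl fun i hi' => ?_
    have h1 : i ≤ j := by
      have := Finset.mem_range.1 hk; have := Finset.mem_range.1 hi'; omega
    have h2 := pow_mul_conj_pow hζ i (j - i)
    rw [Nat.add_sub_cancel' h1] at h2
    rw [← h2, map_mul, map_pow]; ring
  rw [integral_congr_ae e, integral_const_mul, integral_finsetSum _ fun k _ =>
    integrable_finsetSum _ fun i _ => (hIm _).const_mul _]
  rw [Finset.sum_eq_zero, mul_zero]
  intro k hk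
  rw [integral_finsetSum _ fun i _ => (hIm _).const_mul _]
  refine Finset.sum_eq_zero fun i hi' => ?_
  rw [integral_const_mul, hv _ (by
    have := Finset.mem_range.1 hk; have := Finset.mem_range.1 hi'; omega), mul_zero]

lemma err_zero {u : ℂ → ℂ} (hu : Integrable u circleMeasure) (N : ℕ)
    (hz : ∀ j : ℕ, N ≤ j → ∫ ζ, u ζ * ζ ^ j ∂circleMeasure = 0) {b : ℂ} (hb : ‖b‖ < 1) :
    Integrable (fun ζ => u ζ * ((ζ * b) * ((1 - ζ * b)⁻¹ - qN N (ζ * b) ^ 2))) circleMeasure ∧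
    ∫ ζ, u ζ * ((ζ * b) * ((1 - ζ * b)⁻¹ - qN N (ζ * b) ^ 2)) ∂circleMeasure = 0 := by
  have hc : Summable fun k => ‖((1 - gam N k : ℝ) : ℂ) * b ^ k‖ := (hasSum_err N hb).summable.norm
  have hv : Integrable (fun ζ => u ζ * (ζ * b)) circleMeasure :=
    hu.mul_bdd (c := 1) (by fun_prop) (ae_norm.mono fun ζ hζ => by simp [hζ, hb.le])
  have e : ∀ᵐ ζ ∂circleMeasure, u ζ * ((ζ * b) * ((1 - ζ * b)⁻¹ - qN N (ζ * b) ^ 2))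
      = (u ζ * (ζ * b)) * ∑' k, (((1 - gam N k : ℝ) : ℂ) * b ^ k) * ζ ^ k := by
    refine ae_norm.mono fun ζ hζ => ?_
    rw [← (hasSum_err N (x := ζ * b) (by simp [hζ, hb])).tsum_eq, ← mul_assoc]
    congr 1
    exact tsum_congr fun k => by rw [mul_pow]; ring
  refine ⟨(integrable_congr e).2 (hv.mul_bdd (c := ∑' k, ‖((1 - gam N k : ℝ) : ℂ) * b ^ k‖)
    (measurable_series _).aestronglyMeasurable
    (ae_norm.mono fun ζ hζ => norm_series_le hc hζ.le)), ?_⟩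
  rw [integral_congr_ae e]
  have h0 : ∀ k, (((1 - gam N k : ℝ) : ℂ) * b ^ k) *
      ∫ ζ, (u ζ * (ζ * b)) * ζ ^ k ∂circleMeasure = 0 := by
    intro k
    rcases lt_or_ge k N with hk | hk
    · rw [gam_eq_one hk]; simp
    · have : ∀ ζ, (u ζ * (ζ * b)) * ζ ^ k = b * (u ζ * ζ ^ (k + 1)) := fun ζ => by
        rw [pow_succ]; ring
      simp_rw [this]
      rw [integral_const_mul, hz (k + 1) (by omega)]; simp
  have := hasSum_integral_series hc hv
  simp_rw [h0] at this
  exact this.unique hasSum_zero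

lemma poisson_id {y : ℂ} (hy : ‖y‖ < 1) :
    (1 - y)⁻¹ + starRingEnd ℂ y * (1 - starRingEnd ℂ y)⁻¹
      = (((1 - ‖y‖ ^ 2) * ‖(1 - y)⁻¹‖ ^ 2 : ℝ) : ℂ) := by
  have h1 : 1 - y ≠ 0 := fun h => by
    rw [← sub_eq_zero.1 h] at hy; simp at hy
  have h2 : 1 - starRingEnd ℂ y ≠ 0 := fun h => by
    apply h1; have := congrArg (starRingEnd ℂ) h; simpa using this
  push_cast
  rw [← Complex.mul_conj', ← Complex.mul_conj', map_inv₀, map_sub, map_one]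
  field_simp
  ring

/-- the dominating kernel -/
noncomputable def kap (r : ℝ) (N : ℕ) (ζ η : ℂ) : ℝ≥0∞ :=
  ENNReal.ofReal ((1 - r ^ 2) * ‖(1 - (r * starRingEnd ℂ ζ) * η)⁻¹‖ ^ 2)
    + ENNReal.ofReal (‖qN N ((r * ζ) * starRingEnd ℂ η)‖ ^ 2)

lemma measurable_conj : Measurable (fun z : ℂ => starRingEnd ℂ z) :=
  Complex.continuous_conj.measurable

lemma measurable_qN (N : ℕ) : Measurable (qN N) := by
  unfold qN
  fun_prop

lemma measurable_kap (r : ℝ) (N : ℕ) : Measurable (fun p : ℂ × ℂ => kap r N p.1 p.2) := by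
  unfold kap
  have m1 : Measurable fun p : ℂ × ℂ => starRingEnd ℂ p.1 := measurable_conj.comp measurable_fst
  have m2 : Measurable fun p : ℂ × ℂ => starRingEnd ℂ p.2 := measurable_conj.comp measurable_snd
  have m3 : Measurable fun p : ℂ × ℂ => qN N ((r * p.1) * starRingEnd ℂ p.2) :=
    (measurable_qN N).comp ((measurable_fst.const_mul _).mul m2)
  fun_prop

lemma kap_lintegral {r : ℝ} (hr : r ∈ Ioo (0 : ℝ) 1) (N : ℕ) {ζ : ℂ} (hζ : ‖ζ‖ = 1) :
    ∫⁻ η, kap r N ζ η ∂circleMeasure ≤ ENNReal.ofReal (1 + Hm N) := by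
  have hH : 0 ≤ Hm N := Finset.sum_nonneg fun k _ => by positivity
  unfold kap
  rw [lintegral_add_left (by fun_prop), poisson_lintegral hr.1 hr.2 (by
    simp [hζ, abs_of_pos hr.1]), ENNReal.ofReal_add zero_le_one hH, ENNReal.ofReal_one]
  gcongr
  exact qN_lintegral N (by simp [hζ, abs_of_pos hr.1, hr.2.le])

lemma Tn_bound {u : ℂ → ℂ} (hu : Integrable u circleMeasure) (N : ℕ)
    (hz : ∀ j : ℕ, N ≤ j → ∫ ζ, u ζ * ζ ^ j ∂circleMeasure = 0) {r : ℝ}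
    (hr : r ∈ Ioo (0 : ℝ) 1) {η : ℂ} (hη : ‖η‖ = 1) :
    ‖∫ ζ, u ζ / (1 - starRingEnd ℂ ζ * (r * η)) ∂circleMeasure‖ₑ
      ≤ ∫⁻ ζ, ‖u ζ‖ₑ * kap r N ζ η ∂circleMeasure := by
  obtain ⟨i2, e2⟩ := err_zero hu N hz (b := r * starRingEnd ℂ η)
    (by simp [hη, abs_of_pos hr.1, hr.2])
  have i1 : Integrable (fun ζ => u ζ / (1 - starRingEnd ℂ ζ * (r * η))) circleMeasure := by
    simp_rw [div_eq_mul_inv]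
    refine hu.mul_bdd (c := (1 - r)⁻¹) ?_ (ae_norm.mono fun ζ hζ => ?_)
    · exact Measurable.aestronglyMeasurable (by fun_prop)
    · rw [norm_inv]
      refine inv_anti₀ (by linarith [hr.2]) ?_
      have h1 : ‖starRingEnd ℂ ζ * (r * η)‖ = r := by simp [hζ, hη, abs_of_pos hr.1]
      have h2 := norm_sub_norm_le (1 : ℂ) (starRingEnd ℂ ζ * (r * η))
      rw [h1, norm_one] at h2; exact h2
  have e3 : ∫ ζ, u ζ / (1 - starRingEnd ℂ ζ * (r * η)) ∂circleMeasure
      = ∫ ζ, (u ζ / (1 - starRingEnd ℂ ζ * (r * η)) +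
        u ζ * ((ζ * (r * starRingEnd ℂ η)) * ((1 - ζ * (r * starRingEnd ℂ η))⁻¹
          - qN N (ζ * (r * starRingEnd ℂ η)) ^ 2))) ∂circleMeasure := by
    rw [integral_add i1 i2, e2, add_zero]
  rw [e3]
  refine (enorm_integral_le_lintegral_enorm _).trans ?_
  refine lintegral_mono_ae (ae_norm.mono fun ζ hζ => ?_)
  have hy : ‖starRingEnd ℂ ζ * (r * η)‖ = r := by simp [hζ, hη, abs_of_pos hr.1]
  have hx : starRingEnd ℂ (starRingEnd ℂ ζ * (r * η)) = ζ * (r * starRingEnd ℂ η) := by simp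
  have hp := poisson_id (y := starRingEnd ℂ ζ * (r * η)) (by rw [hy]; exact hr.2)
  rw [hx, hy] at hp
  have e4 : u ζ / (1 - starRingEnd ℂ ζ * (r * η)) +
        u ζ * ((ζ * (r * starRingEnd ℂ η)) * ((1 - ζ * (r * starRingEnd ℂ η))⁻¹
          - qN N (ζ * (r * starRingEnd ℂ η)) ^ 2))
      = u ζ * ((((1 - r ^ 2) * ‖(1 - starRingEnd ℂ ζ * (r * η))⁻¹‖ ^ 2 : ℝ) : ℂ)
        - (ζ * (r * starRingEnd ℂ η)) * qN N (ζ * (r * starRingEnd ℂ η)) ^ 2) := by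
    rw [← hp, div_eq_mul_inv]; ring
  rw [e4, enorm_mul]
  gcongr
  have hP : 0 ≤ (1 - r ^ 2) * ‖(1 - starRingEnd ℂ ζ * (r * η))⁻¹‖ ^ 2 :=
    mul_nonneg (by nlinarith [hr.1, hr.2]) (by positivity)
  rw [kap, ← ENNReal.ofReal_add (by
    rw [show r * starRingEnd ℂ ζ * η = starRingEnd ℂ ζ * (r * η) by ring]; exact hP) (by positivity),
    ← ofReal_norm]
  refine ENNReal.ofReal_le_ofReal ?_
  rw [show r * starRingEnd ℂ ζ * η = starRingEnd ℂ ζ * (r * η) by ring,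
    show r * ζ * starRingEnd ℂ η = ζ * (r * starRingEnd ℂ η) by ring]
  refine (norm_sub_le _ _).trans ?_
  rw [Complex.norm_real, Real.norm_of_nonneg hP, norm_mul, norm_pow]
  gcongr
  refine mul_le_of_le_one_left (by positivity) ?_
  simp [hζ, hη, abs_of_pos hr.1, hr.2.le]

lemma kap_aemeas {hs : ℂ → ℂ} (hi : Integrable hs circleMeasure) (r : ℝ) (N : ℕ) :
    AEMeasurable (fun p : ℂ × ℂ => ‖hs p.2‖ₑ * kap r N p.2 p.1)
      (circleMeasure.prod circleMeasure) := by
  have h1 : AEMeasurable (fun p : ℂ × ℂ => ‖hs p.2‖ₑ) (circleMeasure.prod circleMeasure) :=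
    hi.1.enorm.comp_snd
  exact h1.mul ((measurable_kap r N).comp measurable_swap).aemeasurable

lemma kap_tonelli {hs : ℂ → ℂ} (hi : Integrable hs circleMeasure) {r : ℝ}
    (hr : r ∈ Ioo (0 : ℝ) 1) (N : ℕ) :
    ∫⁻ η, ∫⁻ ζ, ‖hs ζ‖ₑ * kap r N ζ η ∂circleMeasure ∂circleMeasure
      ≤ ENNReal.ofReal (1 + Hm N) * ∫⁻ ζ, ‖hs ζ‖ₑ ∂circleMeasure := by
  rw [lintegral_lintegral_swap (f := fun η ζ => ‖hs ζ‖ₑ * kap r N ζ η) (kap_aemeas hi r N),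
    ← lintegral_const_mul' _ _ ENNReal.ofReal_ne_top]
  refine lintegral_mono_ae (ae_norm.mono fun ζ hζ => ?_)
  rw [lintegral_const_mul' _ _ enorm_ne_top, mul_comm]
  gcongr
  exact kap_lintegral hr N hζ

section final
variable {α : ℕ → ℝ} {f : ℂ → ℂ} {hs : ℂ → ℂ}

lemma cesaro_integrable
    (hf : DifferentiableOn ℂ f (Metric.ball (0 : ℂ) 1))
    (hfb : eSupAbs f ≠ ⊤)
    (hi : Integrable hs circleMeasure) (n : ℕ) :
    Integrable (fun ζ => starRingEnd ℂ (cesaro f n ζ) * hs ζ) circleMeasure :=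
  hi.bdd_mul (c := (eSupAbs f).toReal)
    (Complex.continuous_conj.comp (continuous_cesaro n)).aestronglyMeasurable
    (ae_norm.mono fun ζ hζ => by
      rw [Complex.norm_conj]; exact cesaro_norm_le hf hfb n hζ.le)

lemma toeplitz_pointwise
    (hpos : ∀ n, 0 < α n)
    (hdec : ∀ n, α (n + 1) ≤ α n)
    (hconc : ∀ n, 0 ≤ α n - 2 * α (n + 1) + α (n + 2))
    (hsum : Summable fun n => α n / ((n : ℝ) + 1))
    (hf : DifferentiableOn ℂ f (Metric.ball (0 : ℂ) 1))
    (hfb : eSupAbs f ≠ ⊤)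
    (hi : Integrable hs circleMeasure)
    (hv : ∀ j : ℕ, 1 ≤ j → ∫ ζ, hs ζ * ζ ^ j ∂circleMeasure = 0) {r : ℝ} (hr : r ∈ Ioo (0 : ℝ) 1) {η : ℂ} (hη : ‖η‖ = 1) :
    ‖toeplitz (gB f α) hs (r * η)‖ₑ ≤ ∑' n, ENNReal.ofReal (dw α n * (eSupAbs f).toReal) *
      ∫⁻ ζ, ‖hs ζ‖ₑ * kap r (n + 1) ζ η ∂circleMeasure := by
  set M := (eSupAbs f).toReal with hM
  have hM0 : 0 ≤ M := ENNReal.toReal_nonneg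
  have hk : ∀ ζ : ℂ, ‖ζ‖ = 1 → ‖(1 - starRingEnd ℂ ζ * (r * η))⁻¹‖ ≤ (1 - r)⁻¹ := by
    intro ζ hζ
    rw [norm_inv]
    refine inv_anti₀ (by linarith [hr.2]) ?_
    have h1 : ‖starRingEnd ℂ ζ * (r * η)‖ = r := by simp [hζ, hη, abs_of_pos hr.1]
    have h2 := norm_sub_norm_le (1 : ℂ) (starRingEnd ℂ ζ * (r * η))
    rw [h1, norm_one] at h2; exact h2
  set F : ℕ → ℂ → ℂ := fun n ζ => (dw α n : ℂ) *
    (starRingEnd ℂ (cesaro f n ζ) * hs ζ / (1 - starRingEnd ℂ ζ * (r * η))) with hF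
  have hFi : ∀ n, Integrable (F n) circleMeasure := by
    intro n
    refine Integrable.const_mul ?_ _
    simp_rw [div_eq_mul_inv]
    exact (cesaro_integrable hf hfb hi n).mul_bdd (c := (1 - r)⁻¹)
      (Measurable.aestronglyMeasurable (by fun_prop)) (ae_norm.mono hk)
  have hFn : ∀ n, ∀ᵐ ζ ∂circleMeasure, ‖F n ζ‖ ≤ dw α n * (M * (1 - r)⁻¹ * ‖hs ζ‖) := by
    intro n
    refine ae_norm.mono fun ζ hζ => ?_
    simp only [hF]
    rw [div_eq_mul_inv, norm_mul, norm_mul, norm_mul, Complex.norm_real,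
      Real.norm_of_nonneg (dw_nonneg hconc n), Complex.norm_conj]
    refine mul_le_mul_of_nonneg_left ?_ (dw_nonneg hconc n)
    have h1 := cesaro_norm_le hf hfb n hζ.le
    have h2 := hk ζ hζ
    calc _ ≤ M * ‖hs ζ‖ * (1 - r)⁻¹ := by gcongr
      _ = _ := by ring
  have hFs : Summable fun n => ∫ ζ, ‖F n ζ‖ ∂circleMeasure := by
    refine Summable.of_nonneg_of_le (fun n => integral_nonneg fun _ => norm_nonneg _) (fun n => ?_)
      ((dw_summable hpos hdec hconc hsum).mul_right
        (∫ ζ, M * (1 - r)⁻¹ * ‖hs ζ‖ ∂circleMeasure))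
    rw [← integral_const_mul]
    exact integral_mono_ae (hFi n).norm ((hi.norm.const_mul _).const_mul _) (hFn n)
  have hsumF := hasSum_integral_of_summable_integral_norm hFi hFs
  have e1 : toeplitz (gB f α) hs (r * η) = ∫ ζ, ∑' n, F n ζ ∂circleMeasure := by
    unfold toeplitz
    refine integral_congr_ae (ae_norm.mono fun ζ hζ => ?_)
    simp only [hF, gB]
    rw [Complex.conj_tsum, div_eq_mul_inv, mul_assoc, ← tsum_mul_right]
    exact tsum_congr fun n => by
      rw [map_mul, Complex.conj_ofReal, div_eq_mul_inv]; ring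
  rw [e1, ← hsumF.tsum_eq]
  refine enorm_tsum_le_tsum_enorm.trans (ENNReal.tsum_le_tsum fun n => ?_)
  simp only [hF]
  rw [integral_const_mul, enorm_mul, ENNReal.ofReal_mul (dw_nonneg hconc n), mul_assoc]
  have e2 : ‖(dw α n : ℂ)‖ₑ = ENNReal.ofReal (dw α n) := by
    rw [← ofReal_norm, Complex.norm_real, Real.norm_of_nonneg (dw_nonneg hconc n)]
  rw [e2]
  gcongr
  refine (Tn_bound (cesaro_integrable hf hfb hi n) (n + 1) (fun j hj => u_moment hi hv n hj)
    hr hη).trans ?_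
  rw [← lintegral_const_mul' _ _ ENNReal.ofReal_ne_top]
  refine lintegral_mono_ae (ae_norm.mono fun ζ hζ => ?_)
  rw [enorm_mul, mul_assoc]
  gcongr
  rw [← ofReal_norm, Complex.norm_conj]
  exact ENNReal.ofReal_le_ofReal (cesaro_norm_le hf hfb n hζ.le)

lemma toeplitz_bound
    (hpos : ∀ n, 0 < α n)
    (hdec : ∀ n, α (n + 1) ≤ α n)
    (hconc : ∀ n, 0 ≤ α n - 2 * α (n + 1) + α (n + 2))
    (hsum : Summable fun n => α n / ((n : ℝ) + 1))
    (hf : DifferentiableOn ℂ f (Metric.ball (0 : ℂ) 1))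
    (hfb : eSupAbs f ≠ ⊤)
    (hi : Integrable hs circleMeasure)
    (hv : ∀ j : ℕ, 1 ≤ j → ∫ ζ, hs ζ * ζ ^ j ∂circleMeasure = 0) : hardyNorm 1 (toeplitz (gB f α) hs)
    ≤ ENNReal.ofReal (12 * (eSupAbs f).toReal * ∑' n, α n / ((n : ℝ) + 1)) *
      ∫⁻ ζ, ‖hs ζ‖ₑ ∂circleMeasure := by
  refine iSup₂_le fun r hr => ?_
  have hM0 : 0 ≤ (eSupAbs f).toReal := ENNReal.toReal_nonneg
  set M := (eSupAbs f).toReal with hM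
  have hH : ∀ n, 0 ≤ 1 + Hm (n + 1) := fun n => by linarith [one_le_Hm n]
  calc _ ≤ ∫⁻ η, ∑' n, ENNReal.ofReal (dw α n * M) *
      ∫⁻ ζ, ‖hs ζ‖ₑ * kap r (n + 1) ζ η ∂circleMeasure ∂circleMeasure := by
        refine lintegral_mono_ae (ae_norm.mono fun η hη => ?_)
        simp only [Real.rpow_one, ofReal_norm]
        exact toeplitz_pointwise hpos hdec hconc hsum hf hfb hi hv hr hη
    _ = ∑' n, ∫⁻ η, ENNReal.ofReal (dw α n * M) *
      ∫⁻ ζ, ‖hs ζ‖ₑ * kap r (n + 1) ζ η ∂circleMeasure ∂circleMeasure :=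
        lintegral_tsum fun n => (kap_aemeas hi r (n + 1)).lintegral_prod_right'.const_mul _
    _ ≤ ∑' n, ENNReal.ofReal (dw α n * (1 + Hm (n + 1)) * M) *
        ∫⁻ ζ, ‖hs ζ‖ₑ ∂circleMeasure := by
        refine ENNReal.tsum_le_tsum fun n => ?_
        rw [lintegral_const_mul' _ _ ENNReal.ofReal_ne_top]
        refine (mul_le_mul_right (kap_tonelli hi hr (n + 1)) _).trans (le_of_eq ?_)
        rw [← mul_assoc, ← ENNReal.ofReal_mul (mul_nonneg (dw_nonneg hconc n) hM0)]
        congr 2; ring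
    _ = ENNReal.ofReal ((∑' n, dw α n * (1 + Hm (n + 1))) * M) *
        ∫⁻ ζ, ‖hs ζ‖ₑ ∂circleMeasure := by
        rw [ENNReal.tsum_mul_right, ← tsum_mul_right, ENNReal.ofReal_tsum_of_nonneg
          (fun n => mul_nonneg (mul_nonneg (dw_nonneg hconc n) (hH n)) hM0)
          ((weighted_summable hpos hdec hconc hsum).mul_right _)]
    _ ≤ _ := by
        refine mul_le_mul_left (ENNReal.ofReal_le_ofReal ?_) _
        have h1 := mul_le_mul_of_nonneg_right (weighted_tsum_le hpos hdec hconc hsum) hM0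
        refine h1.trans (le_of_eq ?_)
        ring

end final

end HardyAux

/-- **Theorem 2 (boundedness on H¹).** If `α` is a monotone decreasing, concave sequence of
positive numbers with `‖α‖ = ∑ α_n/(n+1) < ∞`, then for every `f ∈ H^∞` the Toeplitz operator
`T_{f*α}` is bounded on `H^1`: for every `h ∈ H^1` with boundary function `h* ∈ L^1(𝕋)`,
`‖T_{f*α} h‖_{H^1} ≤ 12 ‖f‖_{H^∞} ‖α‖ ‖h‖_{H^1}`. -/
theorem toeplitz_conv_bounded_H1 (α : ℕ → ℝ)
    (hpos : ∀ n, 0 < α n)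
    (hdec : ∀ n, α (n + 1) ≤ α n)
    (hconc : ∀ n, 0 ≤ α n - 2 * α (n + 1) + α (n + 2))
    (hsum : Summable fun n => α n / ((n : ℝ) + 1))
    (f : ℂ → ℂ)
    (hf : DifferentiableOn ℂ f (Metric.ball (0 : ℂ) 1))
    (hfb : eSupAbs f ≠ ⊤) :
    ∃ gs : ℂ → ℂ, IsBoundaryFn (seqConv f α) gs ∧
      ∀ h hs : ℂ → ℂ,
        DifferentiableOn ℂ h (Metric.ball (0 : ℂ) 1) →
        hardyNorm 1 h ≠ ⊤ →
        IsBoundaryFn h hs →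
        Integrable hs circleMeasure →
        hardyNorm 1 (toeplitz gs hs) ≤
          ENNReal.ofReal (12 * (eSupAbs f).toReal * ∑' n, α n / ((n : ℝ) + 1)) *
            hardyNorm 1 h := by
  refine ⟨HardyAux.gB f α, HardyAux.gB_boundary hf hpos hdec hconc hsum hfb, ?_⟩
  intro h hs hh hb hbd hi
  refine (HardyAux.toeplitz_bound hpos hdec hconc hsum hf hfb hi
    fun j hj => HardyAux.vanish hh hb hbd hi hj).trans ?_
  exact mul_le_mul_right (HardyAux.boundary_norm_le hh hbd) _
end

section
/- (Theorem 2, boundedness on H^∞.) Let α = (α_n)_{n≥0} be a monotone decreasing sequence of positive real numbers with nondecreasing successive differences (α_n − 2α_{n+1} + α_{n+2} ≥ 0 for all n), and suppose ‖α‖ := ∑_{n≥0} α_n/(n+1) < ∞. Then for every f ∈ H^∞, the Toeplitz operator T_{f*α} is bounded on H^∞: for every h ∈ H^∞ with boundary function h*, ‖T_{f*α} h‖_{H^∞} ≤ 12 ‖f‖_{H^∞} ‖α‖ ‖h‖_{H^∞}. -/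
open MeasureTheory Complex Metric Set
open scoped ENNReal

lemma circle_meas_map : Measurable (fun θ : ℝ => Complex.exp (θ * Complex.I)) := by fun_prop

instance circle_prob : IsProbabilityMeasure circleMeasure := by
  constructor
  rw [circleMeasure, Measure.map_apply circle_meas_map MeasurableSet.univ]
  simp only [preimage_univ, Measure.smul_apply, Measure.restrict_apply MeasurableSet.univ,
    univ_inter, Real.volume_Ioc, sub_zero, smul_eq_mul]
  exact ENNReal.inv_mul_cancel (by simp [Real.pi_pos]) ENNReal.ofReal_ne_top

lemma circle_ae : ∀ᵐ ζ ∂circleMeasure, ζ ∈ sphere (0:ℂ) 1 := by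
  rw [circleMeasure, ae_map_iff circle_meas_map.aemeasurable]
  · exact Filter.Eventually.of_forall fun θ => by
      simp [Complex.norm_exp_ofReal_mul_I]
  · exact isClosed_sphere.measurableSet

lemma circle_restrict : circleMeasure.restrict (sphere (0:ℂ) 1) = circleMeasure :=
  Measure.restrict_eq_self_of_ae_mem circle_ae

lemma circle_integrable {E : Type*} [NormedAddCommGroup E]
    {F : ℂ → E} (hF : ContinuousOn F (sphere (0:ℂ) 1)) : Integrable F circleMeasure := by
  have := hF.integrableOn_compact (μ := circleMeasure) (isCompact_sphere 0 1)
  rwa [IntegrableOn, circle_restrict] at this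

lemma circle_integral_eq {F : ℂ → ℂ} (hF : ContinuousOn F (sphere (0:ℂ) 1)) :
    ∫ ζ, F ζ ∂circleMeasure = Real.circleAverage F 0 1 := by
  have h := (circle_integrable hF).aestronglyMeasurable
  rw [circleMeasure] at h ⊢
  rw [integral_map circle_meas_map.aemeasurable h, Real.circleAverage_def,
    intervalIntegral.integral_of_le (by positivity), integral_smul_measure]
  simp [circleMap, ENNReal.toReal_ofReal Real.pi_pos.le]

lemma circle_integral_anal {F : ℂ → ℂ} (hF : DiffContOnCl ℂ F (ball (0:ℂ) 1)) :
    ∫ ζ, F ζ ∂circleMeasure = F 0 := by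
  rw [circle_integral_eq]
  · exact DiffContOnCl.circleAverage (by simpa using hF)
  · exact hF.continuousOn_ball.mono sphere_subset_closedBall

lemma conj_eq_inv {ζ : ℂ} (h : ζ ∈ sphere (0:ℂ) 1) : (starRingEnd ℂ) ζ * ζ = 1 := by
  rw [mem_sphere_zero_iff_norm] at h
  rw [mul_comm, Complex.mul_conj, Complex.normSq_eq_norm_sq, h]; simp

/-- negative coefficients vanish -/
lemma circle_integral_vanish {F : ℂ → ℂ} (hF : DiffContOnCl ℂ F (ball (0:ℂ) 1)) {j k : ℕ}
    (hjk : k < j) :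
    ∫ ζ, F ζ * ζ ^ j * (starRingEnd ℂ) ζ ^ k ∂circleMeasure = 0 := by
  have : ∫ ζ, F ζ * ζ ^ j * (starRingEnd ℂ) ζ ^ k ∂circleMeasure
      = ∫ ζ, ζ ^ (j-k) • F ζ ∂circleMeasure := by
    apply integral_congr_ae
    filter_upwards [circle_ae] with ζ hζ
    obtain ⟨m, rfl⟩ := Nat.exists_eq_add_of_lt hjk
    have e : k + m + 1 - k = m + 1 := by omega
    rw [e]
    calc _ = F ζ * ζ ^ (m+1) * ((starRingEnd ℂ) ζ * ζ) ^ k := by rw [mul_pow]; ring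
      _ = _ := by rw [conj_eq_inv hζ, smul_eq_mul]; ring
  rw [this, circle_integral_anal]
  · simp [Nat.sub_ne_zero_of_lt hjk]
  · exact DiffContOnCl.smul (Differentiable.diffContOnCl (by fun_prop)) hF

lemma circle_monomial (j k : ℕ) :
    ∫ ζ, ζ ^ j * (starRingEnd ℂ) ζ ^ k ∂circleMeasure = if j = k then 1 else 0 := by
  rcases lt_trichotomy k j with h | h | h
  · have := circle_integral_vanish (F := fun _ => 1) diffContOnCl_const h
    simp only [one_mul] at this
    rw [this, if_neg (by omega)]
  · subst h
    rw [if_pos rfl]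
    have : ∫ ζ, ζ ^ k * (starRingEnd ℂ) ζ ^ k ∂circleMeasure = ∫ ζ : ℂ, (1:ℂ) ∂circleMeasure := by
      apply integral_congr_ae
      filter_upwards [circle_ae] with ζ hζ
      rw [← mul_pow, mul_comm, conj_eq_inv hζ, one_pow]
    rw [this]; simp
  · have := circle_integral_vanish (F := fun _ => 1) diffContOnCl_const h
    simp only [one_mul] at this
    rw [if_neg (by omega)]
    have h2 := congrArg (starRingEnd ℂ) this
    rw [← integral_conj] at h2
    simpa [mul_comm] using h2

/-- finite Parseval -/
lemma circle_parseval (n : ℕ) (a : ℕ → ℂ) :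
    ∫ ζ, ‖∑ k ∈ Finset.range n, a k * ζ ^ k‖ ^ 2 ∂circleMeasure
      = ∑ k ∈ Finset.range n, ‖a k‖ ^ 2 := by
  have key : ∫ ζ, (((‖∑ k ∈ Finset.range n, a k * ζ ^ k‖ ^ 2 : ℝ)) : ℂ) ∂circleMeasure
      = ((∑ k ∈ Finset.range n, ‖a k‖ ^ 2 : ℝ) : ℂ) := by
    have e : ∀ ζ : ℂ, (((‖∑ k ∈ Finset.range n, a k * ζ ^ k‖ ^ 2 : ℝ)) : ℂ)
        = ∑ k ∈ Finset.range n, ∑ l ∈ Finset.range n,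
          (a k * (starRingEnd ℂ) (a l)) * (ζ ^ k * (starRingEnd ℂ) ζ ^ l) := by
      intro ζ
      push_cast
      rw [← Complex.mul_conj', map_sum, Finset.sum_mul_sum]
      refine Finset.sum_congr rfl fun k _ => Finset.sum_congr rfl fun l _ => ?_
      simp only [map_mul, map_pow]; ring
    simp_rw [e]
    rw [integral_finsetSum _ (fun k _ => circle_integrable (by fun_prop))]
    push_cast
    refine Finset.sum_congr rfl fun k hk => ?_
    rw [integral_finsetSum _ (fun k _ => circle_integrable (by fun_prop))]
    simp_rw [integral_const_mul, circle_monomial]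
    simp [Finset.mem_range.1 hk, ← Complex.mul_conj']
  rw [integral_complex_ofReal] at key
  exact_mod_cast key

lemma taylor_hasSum {f : ℂ → ℂ} (hf : DifferentiableOn ℂ f (ball (0 : ℂ) 1)) {z : ℂ}
    (hz : z ∈ ball (0:ℂ) 1) : HasSum (fun n => taylorCoeff f n * z ^ n) (f z) := by
  have := Complex.hasSum_taylorSeries_on_ball (c := 0) (r := 1) (f := f) (by simpa using hf)
    (by simpa using hz)
  refine this.congr_fun fun n => ?_
  simp only [taylorCoeff, smul_eq_mul, sub_zero]
  field_simp

/-- Taylor coefficient formula -/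
lemma circle_coeff {f : ℂ → ℂ} (hf : DifferentiableOn ℂ f (ball (0 : ℂ) 1)) {r : ℝ}
    (hr0 : 0 ≤ r) (hr : r < 1) (k : ℕ) :
    ∫ ζ, f (r * ζ) * (starRingEnd ℂ) ζ ^ k ∂circleMeasure = taylorCoeff f k * r ^ k := by
  have hsm : Summable fun n => ‖taylorCoeff f n‖ * r ^ n := by
    have := (taylor_hasSum hf (z := r) (by simpa [abs_of_nonneg hr0] using hr)).summable.norm
    simpa [abs_of_nonneg hr0] using this
  have hS := hasSum_integral_of_summable_integral_norm (μ := circleMeasure)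
    (F := fun (n : ℕ) (ζ : ℂ) =>
      taylorCoeff f n * (r : ℂ) ^ n * (ζ ^ n * (starRingEnd ℂ) ζ ^ k))
    (fun n => circle_integrable (by fun_prop)) (by
      refine hsm.congr fun n => ?_
      have : ∫ ζ, ‖taylorCoeff f n * (r : ℂ) ^ n * (ζ ^ n * (starRingEnd ℂ) ζ ^ k)‖ ∂circleMeasure
          = ∫ ζ : ℂ, ‖taylorCoeff f n‖ * r ^ n ∂circleMeasure := by
        apply integral_congr_ae
        filter_upwards [circle_ae] with ζ hζ
        rw [mem_sphere_zero_iff_norm] at hζ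
        simp [hζ, abs_of_nonneg hr0]
      rw [this]; simp)
  have e1 : ∫ ζ, f (r * ζ) * (starRingEnd ℂ) ζ ^ k ∂circleMeasure
      = ∫ ζ, ∑' n : ℕ, taylorCoeff f n * (r : ℂ) ^ n * (ζ ^ n * (starRingEnd ℂ) ζ ^ k)
          ∂circleMeasure := by
    apply integral_congr_ae
    filter_upwards [circle_ae] with ζ hζ
    rw [mem_sphere_zero_iff_norm] at hζ
    have := (taylor_hasSum hf (z := r * ζ)
      (by simpa [abs_of_nonneg hr0, hζ] using hr)).mul_right ((starRingEnd ℂ) ζ ^ k)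
    rw [← this.tsum_eq]
    refine tsum_congr fun n => ?_
    rw [mul_pow]; ring
  rw [e1, ← hS.tsum_eq]
  simp_rw [integral_const_mul, circle_monomial]
  rw [tsum_eq_single k (fun n hn => by simp [hn])]
  simp

lemma cesaro_continuous (f : ℂ → ℂ) (n : ℕ) : Continuous (cesaro f n) := by
  unfold cesaro taylorPartial
  fun_prop

lemma mul_differentiableOn_ball {f : ℂ → ℂ} (hf : DifferentiableOn ℂ f (ball (0 : ℂ) 1)) {r : ℝ}
    (hr0 : 0 ≤ r) (hr : r < 1) : DiffContOnCl ℂ (fun ζ => f (r * ζ)) (ball (0:ℂ) 1) := by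
  have : DifferentiableOn ℂ (fun ζ => f (r * ζ)) (closedBall (0:ℂ) 1) := by
    refine hf.comp (by fun_prop) ?_
    intro ζ hζ
    simp only [mem_closedBall_zero_iff, mem_ball_zero_iff, norm_mul, norm_real, Real.norm_eq_abs,
      abs_of_nonneg hr0] at *
    nlinarith [norm_nonneg ζ]
  exact DifferentiableOn.diffContOnCl (by simpa [closure_ball] using this)

lemma cesaro_bound_aux {f : ℂ → ℂ} (hf : DifferentiableOn ℂ f (ball (0 : ℂ) 1)) {M : ℝ}
    (hM : ∀ z ∈ ball (0:ℂ) 1, ‖f z‖ ≤ M) (n : ℕ) {r : ℝ} (hr0 : 0 ≤ r) (hr : r < 1) {z : ℂ}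
    (hz : z ∈ sphere (0:ℂ) 1) : ‖cesaro f n (r * z)‖ ≤ M := by
  have hD := mul_differentiableOn_ball hf hr0 hr
  have hC : ContinuousOn (fun ζ => f (r * ζ)) (sphere (0:ℂ) 1) :=
    hD.continuousOn_ball.mono sphere_subset_closedBall
  have hcont : ∀ (c : ℂ) (k l : ℕ), ContinuousOn
      (fun ζ => c * (f (r * ζ) * ζ ^ k * (starRingEnd ℂ) ζ ^ l)) (sphere (0:ℂ) 1) := fun c k l =>
    continuousOn_const.mul ((hC.mul (by fun_prop)).mul (by fun_prop))
  have e : ∀ ζ : ℂ, f (r * ζ) * (((‖∑ k ∈ Finset.range (n+1), (starRingEnd ℂ) z ^ k * ζ ^ k‖ ^ 2 : ℝ)) : ℂ)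
        = ∑ l ∈ Finset.range (n+1), ∑ k ∈ Finset.range (n+1),
          (z ^ l * (starRingEnd ℂ) z ^ k) * (f (r * ζ) * ζ ^ k * (starRingEnd ℂ) ζ ^ l) := by
    intro ζ
    push_cast
    rw [← Complex.conj_mul', map_sum, Finset.sum_mul_sum, Finset.mul_sum]
    refine Finset.sum_congr rfl fun k _ => ?_
    rw [Finset.mul_sum]
    refine Finset.sum_congr rfl fun l _ => ?_
    simp only [map_mul, map_pow, conj_conj]; ring
  have hcoef : ∀ k l : ℕ, ∫ ζ, f (r * ζ) * ζ ^ k * (starRingEnd ℂ) ζ ^ l ∂circleMeasure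
      = if k ≤ l then taylorCoeff f (l - k) * r ^ (l - k) else 0 := by
    intro k l
    split_ifs with h
    · rw [← circle_coeff hf hr0 hr]
      apply integral_congr_ae
      filter_upwards [circle_ae] with ζ hζ
      obtain ⟨m, rfl⟩ := Nat.exists_eq_add_of_le h
      rw [Nat.add_sub_cancel_left]
      calc _ = f (r * ζ) * (starRingEnd ℂ) ζ ^ m * ((starRingEnd ℂ) ζ * ζ) ^ k := by
            rw [mul_pow]; ring
        _ = _ := by rw [conj_eq_inv hζ]; ring
    · exact circle_integral_vanish hD (by omega)
  have key : ∫ ζ, f (r * ζ) * (((‖∑ k ∈ Finset.range (n+1), (starRingEnd ℂ) z ^ k * ζ ^ k‖ ^ 2 : ℝ)) : ℂ) ∂circleMeasure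
      = ((n:ℂ) + 1) * cesaro f n (r * z) := by
    simp_rw [e]
    have hn : ((n:ℂ) + 1) ≠ 0 := by exact_mod_cast Nat.succ_ne_zero n
    rw [integral_finsetSum _ (fun l _ => circle_integrable
        (continuousOn_finsetSum _ fun k _ => hcont _ k l)), cesaro,
      mul_inv_cancel_left₀ hn]
    refine Finset.sum_congr rfl fun l hl => ?_
    rw [integral_finsetSum _ (fun k _ => circle_integrable (hcont _ k l)), taylorPartial]
    simp_rw [integral_const_mul, hcoef]
    rw [← Finset.sum_range_reflect (fun j => taylorCoeff f j * ((r:ℂ) * z) ^ j)]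
    have hl' := Finset.mem_range.1 hl
    rw [← Finset.sum_subset (Finset.range_subset_range.2 (show l + 1 ≤ n + 1 by omega))]
    · refine Finset.sum_congr rfl fun k hk => ?_
      have hk' := Finset.mem_range.1 hk
      rw [if_pos (by omega)]
      obtain ⟨m, rfl⟩ := Nat.exists_eq_add_of_le (show k ≤ l by omega)
      have e1 : k + m - k = m := by omega
      have e2 : k + m + 1 - 1 - k = m := by omega
      rw [e1, e2]
      calc _ = taylorCoeff f m * r ^ m * z ^ m * ((starRingEnd ℂ) z * z) ^ k := by
            rw [mul_pow]; ring
        _ = _ := by rw [conj_eq_inv hz, mul_pow]; ring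
    · intro k _ hk
      rw [if_neg (by simpa using hk), mul_zero]
  have hb : ‖((n:ℂ) + 1) * cesaro f n (r * z)‖ ≤ M * (n + 1) := by
    rw [← key]
    have hz' := mem_sphere_zero_iff_norm.1 hz
    have hp := circle_parseval (n+1) (fun k => (starRingEnd ℂ) z ^ k)
    simp only [norm_pow, RCLike.norm_conj, hz', one_pow, Finset.sum_const, Finset.card_range,
      nsmul_eq_mul, mul_one] at hp
    push_cast at hp
    rw [← hp, ← integral_const_mul]
    apply norm_integral_le_of_norm_le (circle_integrable (by fun_prop))
    filter_upwards [circle_ae] with ζ hζ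
    rw [norm_mul, norm_real, Real.norm_of_nonneg (by positivity)]
    gcongr
    apply hM
    rw [mem_sphere_zero_iff_norm] at hζ
    simpa [hζ, abs_of_nonneg hr0] using hr
  have hn : ‖((n:ℂ) + 1)‖ = n + 1 := by
    have : ((n:ℂ) + 1) = ((n + 1 : ℕ) : ℂ) := by push_cast; rfl
    rw [this, Complex.norm_natCast]; push_cast; rfl
  rw [norm_mul, hn, mul_comm] at hb
  exact le_of_mul_le_mul_right hb (by positivity)

lemma cesaro_bound {f : ℂ → ℂ} (hf : DifferentiableOn ℂ f (ball (0 : ℂ) 1)) {M : ℝ}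
    (hM : ∀ z ∈ ball (0:ℂ) 1, ‖f z‖ ≤ M) (n : ℕ) {z : ℂ}
    (hz : z ∈ closedBall (0:ℂ) 1) : ‖cesaro f n z‖ ≤ M := by
  have hcl : IsClosed {z | ‖cesaro f n z‖ ≤ M} :=
    isClosed_le (cesaro_continuous f n).norm continuous_const
  rw [← closure_ball (0:ℂ) one_ne_zero] at hz
  refine closure_minimal ?_ hcl hz
  intro u hu
  have := cesaro_bound_aux hf hM n (norm_nonneg u) (by simpa using hu) (z := exp (arg u * I))
    (by simp [Complex.norm_exp_ofReal_mul_I])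
  rwa [Complex.norm_mul_exp_arg_mul_I] at this

noncomputable def landauC : ℕ → ℝ
  | 0 => 1
  | k + 1 => landauC k * (2 * k + 1) / (2 * k + 2)

lemma landauC_sq (k : ℕ) : 0 ≤ landauC k ∧ landauC k ^ 2 ≤ 1 / ((k:ℝ) + 1) := by
  induction k with
  | zero => simp [landauC]
  | succ k ih =>
    obtain ⟨h0, h1⟩ := ih
    refine ⟨by rw [landauC]; positivity, ?_⟩
    rw [landauC, div_pow, mul_pow]
    calc _ ≤ 1 / ((k:ℝ) + 1) * (2 * k + 1) ^ 2 / (2 * k + 2) ^ 2 := by gcongr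
      _ ≤ _ := by
        push_cast
        rw [one_div_mul_eq_div, div_div, div_le_div_iff₀ (by positivity) (by positivity)]
        nlinarith [(Nat.cast_nonneg k : (0:ℝ) ≤ k)]

lemma landau_half (m : ℕ) :
    2 * ∑ p ∈ Finset.HasAntidiagonal.antidiagonal m, (p.1:ℝ) * (landauC p.1 * landauC p.2)
      = m * ∑ p ∈ Finset.HasAntidiagonal.antidiagonal m, landauC p.1 * landauC p.2 := by
  have h := Finset.Nat.sum_antidiagonal_swap (n := m)
    (f := fun p => (p.1:ℝ) * (landauC p.1 * landauC p.2))
  rw [two_mul]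
  nth_rw 1 [← h]
  rw [← Finset.sum_add_distrib, Finset.mul_sum]
  refine Finset.sum_congr rfl fun p hp => ?_
  have := Finset.HasAntidiagonal.mem_antidiagonal.1 hp
  rw [← this]; push_cast; simp only [Prod.fst_swap, Prod.snd_swap]; ring

lemma landau_conv (m : ℕ) :
    ∑ p ∈ Finset.HasAntidiagonal.antidiagonal m, landauC p.1 * landauC p.2 = 1 := by
  induction m with
  | zero => simp [landauC]
  | succ m ih =>
    have h1 := landau_half (m+1)
    have h2 := landau_half m
    rw [ih] at h2
    rw [Finset.Nat.sum_antidiagonal_succ] at h1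
    have h3 : ∑ p ∈ Finset.HasAntidiagonal.antidiagonal m, (((p.1 + 1 : ℕ):ℝ)) * (landauC (p.1+1) * landauC p.2)
       = ∑ p ∈ Finset.HasAntidiagonal.antidiagonal m, (p.1:ℝ) * (landauC p.1 * landauC p.2)
        + (1/2) * ∑ p ∈ Finset.HasAntidiagonal.antidiagonal m, landauC p.1 * landauC p.2 := by
      rw [Finset.mul_sum, ← Finset.sum_add_distrib]
      refine Finset.sum_congr rfl fun p hp => ?_
      rw [landauC]; push_cast; field_simp
    rw [h3, ih] at h1
    push_cast at h1
    have hm : (m:ℝ) + 1 ≠ 0 := by positivity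
    apply mul_left_cancel₀ hm
    rw [← h1]; linarith

open Polynomial in
lemma landau_poly (n : ℕ) : ∃ R : ℂ[X], ∀ w : ℂ,
    (1 - w) * (∑ k ∈ Finset.range n, (landauC k : ℂ) * w ^ k) ^ 2 = 1 + w ^ n * R.eval w := by
  set Q : ℂ[X] := ∑ k ∈ Finset.range n, C (landauC k : ℂ) * X ^ k with hQ
  have hc : ∀ d < n, Q.coeff d = landauC d := by
    intro d hd
    simp [hQ, hd]
  have hcc : ∀ d < n, (Q ^ 2).coeff d = 1 := by
    intro d hd
    rw [sq, coeff_mul]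
    have := congrArg (fun x : ℝ => (x : ℂ)) (landau_conv d)
    push_cast at this
    rw [← this]
    refine Finset.sum_congr rfl fun p hp => ?_
    have := Finset.HasAntidiagonal.mem_antidiagonal.1 hp
    rw [hc _ (by omega), hc _ (by omega)]
  have hdvd : X ^ n ∣ (1 - X) * Q ^ 2 - 1 := by
    rw [X_pow_dvd_iff]
    intro d hd
    rw [sub_mul, one_mul, coeff_sub, coeff_sub, hcc d hd]
    cases d with
    | zero => simp
    | succ e => rw [coeff_X_mul, hcc e (by omega)]; simp [coeff_one]
  obtain ⟨R, hR⟩ := hdvd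
  refine ⟨R, fun w => ?_⟩
  have := congrArg (Polynomial.eval w) hR
  simp only [hQ, eval_sub, eval_mul, eval_pow, eval_one, eval_X, eval_finsetSum, eval_C] at this
  linear_combination this

lemma cesaro_poly (f : ℂ → ℂ) (n : ℕ) : ∃ b : ℕ → ℂ, ∀ z,
    cesaro f n z = ∑ k ∈ Finset.range (n + 1), b k * z ^ k := by
  refine ⟨fun k => ((n : ℂ) + 1)⁻¹ * ∑ l ∈ Finset.range (n + 1),
    if k < l + 1 then taylorCoeff f k else 0, fun z => ?_⟩
  simp only [cesaro, taylorPartial, mul_assoc, ← Finset.mul_sum]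
  congr 1
  simp only [Finset.sum_mul]
  rw [Finset.sum_comm]
  refine Finset.sum_congr rfl fun l hl => ?_
  have hl' := Finset.mem_range.1 hl
  rw [← Finset.sum_subset (Finset.range_subset_range.2 (show l + 1 ≤ n + 1 by omega))]
  · refine Finset.sum_congr rfl fun k hk => ?_
    rw [if_pos (Finset.mem_range.1 hk)]
  · intro k _ hk
    rw [if_neg (by simpa using hk), zero_mul]

lemma one_sub_ne {z ζ : ℂ} (hz : ‖z‖ < 1) (hζ : ‖ζ‖ ≤ 1) : 1 - z * ζ ≠ 0 := by
  intro h
  have h1 : z * ζ = 1 := (sub_eq_zero.1 h).symm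
  have h2 : ‖z‖ * ‖ζ‖ = 1 := by rw [← norm_mul, h1, norm_one]
  nlinarith [norm_nonneg z, norm_nonneg ζ]

lemma diffCont_kernel {z : ℂ} (hz : ‖z‖ < 1) :
    DiffContOnCl ℂ (fun ζ => (1 - z * ζ)⁻¹) (ball (0:ℂ) 1) := by
  apply DifferentiableOn.diffContOnCl
  rw [closure_ball _ one_ne_zero]
  refine DifferentiableOn.inv (by fun_prop) fun ζ hζ => one_sub_ne hz (by simpa using hζ)

noncomputable def poissonK (z ζ : ℂ) : ℝ := (1 - ‖z‖ ^ 2) / ‖1 - (starRingEnd ℂ) z * ζ‖ ^ 2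

lemma poissonK_eq {z ζ : ℂ} (hz : ‖z‖ < 1) (hζ : ζ ∈ sphere (0:ℂ) 1) :
    (poissonK z ζ : ℂ) = (starRingEnd ℂ) ((1 - (starRingEnd ℂ) z * ζ)⁻¹)
      + ((starRingEnd ℂ) z * ζ) * (1 - (starRingEnd ℂ) z * ζ)⁻¹ := by
  have hζ' := mem_sphere_zero_iff_norm.1 hζ
  have h1 := one_sub_ne (z := (starRingEnd ℂ) z) (ζ := ζ) (by simpa using hz) hζ'.le
  have h2 : 1 - z * (starRingEnd ℂ) ζ ≠ 0 := one_sub_ne hz (by simp [hζ'])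
  have h3 := conj_eq_inv hζ
  unfold poissonK
  push_cast
  rw [← Complex.mul_conj', ← Complex.mul_conj']
  simp only [map_inv₀, map_sub, map_mul, map_one, conj_conj]
  field_simp
  linear_combination (z * (starRingEnd ℂ) z) * h3

lemma poissonK_cont {z : ℂ} (hz : ‖z‖ < 1) : ContinuousOn (poissonK z) (sphere (0:ℂ) 1) := by
  unfold poissonK
  refine ContinuousOn.div (by fun_prop) (by fun_prop) fun ζ hζ => ?_
  have := one_sub_ne (z := (starRingEnd ℂ) z) (ζ := ζ) (by simpa using hz)
    (mem_sphere_zero_iff_norm.1 hζ).le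
  positivity

lemma poissonK_integral {z : ℂ} (hz : ‖z‖ < 1) : ∫ ζ, poissonK z ζ ∂circleMeasure = 1 := by
  have hz' : ‖(starRingEnd ℂ) z‖ < 1 := by simpa using hz
  have hK := diffCont_kernel hz'
  have hKc := hK.continuousOn_ball.mono sphere_subset_closedBall
  have key : ∫ ζ, (poissonK z ζ : ℂ) ∂circleMeasure = 1 := by
    rw [integral_congr_ae (g := fun ζ => (starRingEnd ℂ) ((1 - (starRingEnd ℂ) z * ζ)⁻¹)
      + ((starRingEnd ℂ) z * ζ) * (1 - (starRingEnd ℂ) z * ζ)⁻¹)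
      (by filter_upwards [circle_ae] with ζ hζ using poissonK_eq hz hζ)]
    rw [integral_add, integral_conj, circle_integral_anal hK, circle_integral_anal]
    · simp
    · exact DiffContOnCl.smul (f := fun ζ => (1 - (starRingEnd ℂ) z * ζ)⁻¹)
        (c := fun ζ => (starRingEnd ℂ) z * ζ)
        (Differentiable.diffContOnCl (by fun_prop)) hK
    · exact circle_integrable (Complex.continuous_conj.comp_continuousOn hKc)
    · exact circle_integrable (ContinuousOn.mul (by fun_prop) hKc)
  rw [integral_complex_ofReal] at key
  exact_mod_cast key

noncomputable def harm (n : ℕ) : ℝ := ∑ k ∈ Finset.range n, 1 / ((k:ℝ) + 1)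

/-- key estimate -/
lemma toeplitz_poly {p H : ℂ → ℂ} {n : ℕ} {b : ℕ → ℂ} {M M' : ℝ} {z : ℂ}
    (hM : 0 ≤ M) (hM' : 0 ≤ M')
    (hp : ∀ ζ, p ζ = ∑ k ∈ Finset.range (n + 1), b k * ζ ^ k)
    (hpM : ∀ ζ ∈ sphere (0:ℂ) 1, ‖p ζ‖ ≤ M)
    (hH : DiffContOnCl ℂ H (ball (0:ℂ) 1))
    (hHM : ∀ ζ ∈ sphere (0:ℂ) 1, ‖H ζ‖ ≤ M') (hz : ‖z‖ < 1) :
    ‖∫ ζ, (starRingEnd ℂ) (p ζ) * H ζ / (1 - (starRingEnd ℂ) ζ * z) ∂circleMeasure‖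
      ≤ M * M' * (1 + harm n) := by
  obtain ⟨R, hR⟩ := landau_poly n
  have hz' : ‖(starRingEnd ℂ) z‖ < 1 := by simpa using hz
  have hK := diffCont_kernel hz'
  have hKc := hK.continuousOn_ball.mono sphere_subset_closedBall
  have hHc := hH.continuousOn_ball.mono sphere_subset_closedBall
  have hpc : Continuous p := by
    have : p = fun ζ => ∑ k ∈ Finset.range (n + 1), b k * ζ ^ k := funext hp
    rw [this]; fun_prop
  set Q : ℂ → ℂ := fun ζ =>
    ∑ k ∈ Finset.range n, (landauC k : ℂ) * ((starRingEnd ℂ) z * ζ) ^ k with hQ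
  have hQc : Continuous Q := by rw [hQ]; fun_prop
  have hPc := poissonK_cont hz
  have hPc' : ContinuousOn (fun ζ => (poissonK z ζ : ℂ)) (sphere (0:ℂ) 1) :=
    Complex.continuous_ofReal.comp_continuousOn hPc
  set Φ : ℂ → ℂ := fun ζ => (R.eval ((starRingEnd ℂ) z * ζ)) • ((1 - (starRingEnd ℂ) z * ζ)⁻¹ • H ζ)
    with hΦ
  have hΦd : DiffContOnCl ℂ Φ (ball (0:ℂ) 1) :=
    DiffContOnCl.smul (Differentiable.diffContOnCl
      (R.differentiable.comp (by fun_prop : Differentiable ℂ fun ζ : ℂ => (starRingEnd ℂ) z * ζ)))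
      (hK.smul hH)
  have hΦc := hΦd.continuousOn_ball.mono sphere_subset_closedBall
  -- decomposition
  have hdec : ∫ ζ, (starRingEnd ℂ) (p ζ) * H ζ / (1 - (starRingEnd ℂ) ζ * z) ∂circleMeasure
      = ∫ ζ, ((starRingEnd ℂ) (p ζ) * H ζ * ((poissonK z ζ : ℂ) - ((starRingEnd ℂ) z * ζ) * Q ζ ^ 2)
        + ∑ k ∈ Finset.range (n + 1), ((starRingEnd ℂ) (b k) * (starRingEnd ℂ) z ^ (n+1)) *
          (Φ ζ * ζ ^ (n+1) * (starRingEnd ℂ) ζ ^ k)) ∂circleMeasure := by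
    apply integral_congr_ae
    filter_upwards [circle_ae] with ζ hζ
    have hζ' := mem_sphere_zero_iff_norm.1 hζ
    have h1 := one_sub_ne (z := (starRingEnd ℂ) z) (ζ := ζ) (by simpa using hz) hζ'.le
    have h2 : 1 - z * (starRingEnd ℂ) ζ ≠ 0 := one_sub_ne hz (by simp [hζ'])
    have hs : ∑ k ∈ Finset.range (n + 1), ((starRingEnd ℂ) (b k) * (starRingEnd ℂ) z ^ (n+1)) *
          (Φ ζ * ζ ^ (n+1) * (starRingEnd ℂ) ζ ^ k)
        = (starRingEnd ℂ) (p ζ) * ((starRingEnd ℂ) z * ζ) ^ (n+1) * Φ ζ := by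
      rw [hp, map_sum, Finset.sum_mul, Finset.sum_mul]
      refine Finset.sum_congr rfl fun k _ => ?_
      simp only [map_mul, map_pow]; ring
    rw [hs, poissonK_eq hz hζ]
    have hRR := hR ((starRingEnd ℂ) z * ζ)
    change (1 - (starRingEnd ℂ) z * ζ) * Q ζ ^ 2 = _ at hRR
    have hR2 : Q ζ ^ 2 = (1 - (starRingEnd ℂ) z * ζ)⁻¹ * (1 + ((starRingEnd ℂ) z * ζ) ^ n *
      R.eval ((starRingEnd ℂ) z * ζ)) := by
      rw [← hRR, inv_mul_cancel_left₀ h1]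
    rw [hR2]
    simp only [hΦ, smul_eq_mul, map_inv₀, map_sub, map_mul, map_one, conj_conj]
    rw [mul_comm ((starRingEnd ℂ) ζ) z, div_eq_mul_inv]
    ring
  have hcont : ∀ (c : ℂ) (k : ℕ), ContinuousOn
      (fun ζ => c * (Φ ζ * ζ ^ (n+1) * (starRingEnd ℂ) ζ ^ k)) (sphere (0:ℂ) 1) := fun c k =>
    continuousOn_const.mul ((hΦc.mul (by fun_prop)).mul (by fun_prop))
  rw [hdec, integral_add]
  rotate_left
  · refine circle_integrable (ContinuousOn.mul (ContinuousOn.mul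
      (Complex.continuous_conj.comp hpc).continuousOn hHc) (hPc'.sub ?_))
    exact (Continuous.mul (by fun_prop) (hQc.pow 2)).continuousOn
  · exact circle_integrable (continuousOn_finsetSum _ fun k _ => hcont _ k)
  rw [integral_finsetSum _ (fun k _ => circle_integrable (hcont _ k))]
  have hzero : ∀ k ∈ Finset.range (n+1), ∫ ζ, ((starRingEnd ℂ) (b k) * (starRingEnd ℂ) z ^ (n+1)) *
          (Φ ζ * ζ ^ (n+1) * (starRingEnd ℂ) ζ ^ k) ∂circleMeasure = 0 := by
    intro k hk
    rw [integral_const_mul, circle_integral_vanish hΦd (Finset.mem_range.1 hk), mul_zero]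
  rw [Finset.sum_eq_zero hzero, add_zero]
  have hQ2 : ∫ ζ, ‖Q ζ‖ ^ 2 ∂circleMeasure ≤ harm n := by
    have := circle_parseval n (fun k => (landauC k : ℂ) * (starRingEnd ℂ) z ^ k)
    have e : ∀ ζ, Q ζ = ∑ k ∈ Finset.range n, (landauC k : ℂ) * (starRingEnd ℂ) z ^ k * ζ ^ k := by
      intro ζ
      simp only [hQ, mul_pow, mul_assoc]
    simp_rw [e, this, harm]
    refine Finset.sum_le_sum fun k _ => ?_
    have h1 := landauC_sq k
    rw [norm_mul, mul_pow, norm_real, Real.norm_of_nonneg h1.1]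
    have h2 : ‖(starRingEnd ℂ) z ^ k‖ ^ 2 ≤ 1 := by
      rw [norm_pow, ← pow_mul]
      exact pow_le_one₀ (norm_nonneg _) hz'.le
    nlinarith [sq_nonneg (landauC k)]
  calc _ ≤ ∫ ζ, M * M' * (poissonK z ζ + ‖Q ζ‖ ^ 2) ∂circleMeasure := by
        apply norm_integral_le_of_norm_le
        · exact circle_integrable (continuousOn_const.mul
            (hPc.add (hQc.norm.pow 2).continuousOn))
        · filter_upwards [circle_ae] with ζ hζ
          have hζ' := mem_sphere_zero_iff_norm.1 hζ
          have hP0 : 0 ≤ poissonK z ζ := by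
            unfold poissonK
            have : 0 ≤ 1 - ‖z‖ ^ 2 := by nlinarith [norm_nonneg z]
            positivity
          rw [norm_mul, norm_mul, RCLike.norm_conj]
          have : ‖(poissonK z ζ : ℂ) - ((starRingEnd ℂ) z * ζ) * Q ζ ^ 2‖
              ≤ poissonK z ζ + ‖Q ζ‖ ^ 2 := by
            refine (norm_sub_le _ _).trans ?_
            rw [norm_real, Real.norm_of_nonneg hP0, norm_mul, norm_mul, norm_pow, hζ', mul_one]
            nlinarith [sq_nonneg ‖Q ζ‖]
          have h1 := hpM ζ hζ
          have h2 := hHM ζ hζ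
          gcongr
    _ = M * M' * (1 + ∫ ζ, ‖Q ζ‖ ^ 2 ∂circleMeasure) := by
        rw [integral_const_mul, integral_add (circle_integrable hPc)
          (circle_integrable (F := fun ζ => ‖Q ζ‖ ^ 2) (hQc.norm.pow 2).continuousOn),
          poissonK_integral hz]
    _ ≤ _ := by gcongr

lemma abel_twice {𝕜 : Type*} [CommRing 𝕜] (α b : ℕ → 𝕜) (N : ℕ) :
    ∑ n ∈ Finset.range N, α n * b n =
      ∑ n ∈ Finset.range N, (α n - 2 * α (n+1) + α (n+2)) *
          (∑ k ∈ Finset.range (n+1), ∑ j ∈ Finset.range (k+1), b j)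
        + (α N - α (N+1)) * (∑ k ∈ Finset.range N, ∑ j ∈ Finset.range (k+1), b j)
        + α N * ∑ j ∈ Finset.range N, b j := by
  induction N with
  | zero => simp
  | succ N ih =>
    rw [Finset.sum_range_succ (fun n => α n * b n), ih, Finset.sum_range_succ (fun n =>
      (α n - 2 * α (n+1) + α (n+2)) * (∑ k ∈ Finset.range (n+1), ∑ j ∈ Finset.range (k+1), b j)),
      Finset.sum_range_succ (fun k => ∑ j ∈ Finset.range (k+1), b j),
      Finset.sum_range_succ b]
    ring

noncomputable def wt (n : ℕ) : ℝ := if n = 0 then 1 else 1 / (n:ℝ)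

lemma wt_sum (n : ℕ) : ∑ j ∈ Finset.range (n+1), wt j = 1 + harm n := by
  rw [Finset.sum_range_succ', harm, add_comm]
  simp [wt]

lemma harm_nonneg (n : ℕ) : 0 ≤ harm n := Finset.sum_nonneg fun k _ => by positivity

lemma harm_succ (n : ℕ) : harm (n+1) = harm n + 1 / ((n:ℝ) + 1) := Finset.sum_range_succ _ _

lemma wt_sum2 (n : ℕ) :
    ∑ k ∈ Finset.range (n+1), ∑ j ∈ Finset.range (k+1), wt j = ((n:ℝ)+1) * harm (n+1) := by
  simp_rw [wt_sum]
  induction n with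
  | zero => simp [harm]
  | succ n ih =>
    rw [Finset.sum_range_succ, ih, harm_succ (n+1), harm_succ n]
    push_cast
    field_simp
    ring

lemma weight_bound {α : ℕ → ℝ} (hpos : ∀ n, 0 < α n)
    (hdec : ∀ n, α (n + 1) ≤ α n)
    (hconc : ∀ n, 0 ≤ α n - 2 * α (n + 1) + α (n + 2))
    (hsum : Summable fun n => α n / ((n : ℝ) + 1)) (N : ℕ) :
    ∑ n ∈ Finset.range N, (α n - 2 * α (n+1) + α (n+2)) * (((n:ℝ)+1) * (1 + harm n))
      ≤ 4 * ∑' n, α n / ((n:ℝ)+1) := by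
  have hab := abel_twice α wt N
  simp_rw [wt_sum2] at hab
  have hw : ∀ n, 0 ≤ wt n := fun n => by unfold wt; split_ifs <;> positivity
  have h1 : 0 ≤ (α N - α (N+1)) * (∑ k ∈ Finset.range N, ∑ j ∈ Finset.range (k+1), wt j) :=
    mul_nonneg (by linarith [hdec N]) (Finset.sum_nonneg fun k _ => Finset.sum_nonneg fun j _ => hw j)
  have h2 : 0 ≤ α N * ∑ j ∈ Finset.range N, wt j :=
    mul_nonneg (hpos N).le (Finset.sum_nonneg fun j _ => hw j)
  have h3 : ∑ n ∈ Finset.range N, α n * wt n ≤ 2 * ∑' n, α n / ((n:ℝ)+1) := by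
    refine le_trans ?_ (mul_le_mul_of_nonneg_left
      (hsum.sum_le_tsum (Finset.range N) (fun n _ => div_nonneg (hpos n).le (by positivity)))
      (by norm_num))
    rw [Finset.mul_sum]
    refine Finset.sum_le_sum fun n _ => ?_
    have : wt n ≤ 2 / ((n:ℝ)+1) := by
      unfold wt
      split_ifs with h
      · subst h; norm_num
      · have : (1:ℝ) ≤ n := by exact_mod_cast Nat.one_le_iff_ne_zero.2 h
        rw [div_le_div_iff₀ (by positivity) (by positivity)]
        linarith
    calc α n * wt n ≤ α n * (2 / ((n:ℝ)+1)) := mul_le_mul_of_nonneg_left this (hpos n).le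
      _ = _ := by ring
  have h4 : ∑ n ∈ Finset.range N, (α n - 2 * α (n+1) + α (n+2)) * (((n:ℝ)+1) * (1 + harm n))
      ≤ 2 * ∑ n ∈ Finset.range N, (α n - 2 * α (n+1) + α (n+2)) * (((n:ℝ)+1) * harm (n+1)) := by
    rw [Finset.mul_sum]
    refine Finset.sum_le_sum fun n _ => ?_
    have hh : 1 + harm n ≤ 2 * harm (n+1) := by
      have h1 : harm n ≤ harm (n+1) := by rw [harm_succ]; linarith [show 0 ≤ 1 / ((n:ℝ)+1) by positivity]
      have h2 : 1 ≤ harm (n+1) := by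
        unfold harm
        rw [Finset.sum_range_succ']
        have : 0 ≤ ∑ k ∈ Finset.range n, 1 / (((k + 1 : ℕ):ℝ) + 1) :=
          Finset.sum_nonneg fun k _ => by positivity
        simpa using this
      linarith
    have := mul_le_mul_of_nonneg_left (mul_le_mul_of_nonneg_left hh (show (0:ℝ) ≤ (n:ℝ)+1 by positivity)) (hconc n)
    linarith
  linarith

lemma alpha_tendsto {α : ℕ → ℝ} (hpos : ∀ n, 0 < α n)
    (hdec : ∀ n, α (n + 1) ≤ α n)
    (hsum : Summable fun n => α n / ((n : ℝ) + 1)) : Filter.Tendsto α Filter.atTop (nhds 0) := by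
  have hanti : Antitone α := antitone_nat_of_succ_le hdec
  have hbdd : BddBelow (range α) := ⟨0, by rintro _ ⟨n, rfl⟩; exact (hpos n).le⟩
  have ht := tendsto_atTop_ciInf hanti hbdd
  set L := ⨅ n, α n
  have hL0 : 0 ≤ L := le_ciInf fun n => (hpos n).le
  have hLn : ∀ n, L ≤ α n := fun n => ciInf_le hbdd n
  rcases hL0.eq_or_lt with h | h
  · rwa [← h] at ht
  · exfalso
    have : Summable fun n : ℕ => L / ((n:ℝ)+1) := by
      refine Summable.of_nonneg_of_le (fun n => by positivity) (fun n => ?_) hsum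
      have := hLn n
      gcongr
    have h2 : Summable fun n : ℕ => 1 / ((n + 1 : ℕ) : ℝ) := by
      refine (this.mul_left L⁻¹).congr fun n => ?_
      push_cast
      field_simp
    exact Real.not_summable_one_div_natCast ((summable_nat_add_iff (f := fun n : ℕ => 1 / (n:ℝ)) 1).1 h2)

lemma diff_bound {α : ℕ → ℝ} (hconc : ∀ n, 0 ≤ α n - 2 * α (n + 1) + α (n + 2)) (k j : ℕ) : j * (α (k+j) - α (k+j+1)) ≤ α k - α (k+j) := by
  induction j with
  | zero => simp
  | succ j ih =>
    have := hconc (k+j)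
    rw [← add_assoc]
    push_cast
    have e : k + j + 1 + 1 = k + j + 2 := rfl
    rw [e]
    nlinarith [mul_nonneg (Nat.cast_nonneg j : (0:ℝ) ≤ j) this]

lemma n_diff_tendsto {α : ℕ → ℝ} (hpos : ∀ n, 0 < α n)
    (hdec : ∀ n, α (n + 1) ≤ α n)
    (hconc : ∀ n, 0 ≤ α n - 2 * α (n + 1) + α (n + 2))
    (hsum : Summable fun n => α n / ((n : ℝ) + 1)) :
    Filter.Tendsto (fun N : ℕ => (N:ℝ) * (α N - α (N+1))) Filter.atTop (nhds 0) := by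
  have h1 : Filter.Tendsto (fun N : ℕ => 2 * α (N / 2)) Filter.atTop (nhds 0) := by
    have := ((alpha_tendsto hpos hdec hsum).comp (Nat.tendsto_div_const_atTop (two_ne_zero))).const_mul 2
    simpa using this
  refine squeeze_zero (fun N => mul_nonneg (Nat.cast_nonneg N) (by linarith [hdec N])) (fun N => ?_) h1
  have h := diff_bound hconc (N/2) (N - N/2)
  rw [Nat.add_sub_of_le (Nat.div_le_self N 2)] at h
  have h2 : (N:ℝ) ≤ 2 * ((N - N/2 : ℕ) : ℝ) := by
    have : N ≤ 2 * (N - N/2) := by omega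
    exact_mod_cast this
  have h3 : 0 ≤ α N - α (N+1) := by linarith [hdec N]
  nlinarith [hpos N]

/-- the uniformly convergent Cesàro series -/
noncomputable def bdry (f : ℂ → ℂ) (α : ℕ → ℝ) (z : ℂ) : ℂ :=
  ∑' n : ℕ, (((α n - 2 * α (n+1) + α (n+2)) * ((n:ℝ)+1) : ℝ) : ℂ) * cesaro f n z

section main
variable {α : ℕ → ℝ}

lemma coef_bound (hpos : ∀ n, 0 < α n) (hdec : ∀ n, α (n + 1) ≤ α n)
    (hconc : ∀ n, 0 ≤ α n - 2 * α (n + 1) + α (n + 2))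
    (hsum : Summable fun n => α n / ((n : ℝ) + 1)) (N : ℕ) :
    ∑ n ∈ Finset.range N, (α n - 2 * α (n+1) + α (n+2)) * ((n:ℝ)+1)
      ≤ 4 * ∑' n, α n / ((n:ℝ)+1) := by
  refine le_trans (Finset.sum_le_sum fun n _ => ?_) (weight_bound hpos hdec hconc hsum N)
  refine mul_le_mul_of_nonneg_left ?_ (hconc n)
  have := mul_nonneg (show (0:ℝ) ≤ (n:ℝ)+1 by positivity) (harm_nonneg n)
  linarith

lemma coef_summable (hpos : ∀ n, 0 < α n) (hdec : ∀ n, α (n + 1) ≤ α n)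
    (hconc : ∀ n, 0 ≤ α n - 2 * α (n + 1) + α (n + 2))
    (hsum : Summable fun n => α n / ((n : ℝ) + 1)) :
    Summable fun n : ℕ => (α n - 2 * α (n+1) + α (n+2)) * ((n:ℝ)+1) :=
  summable_of_sum_range_le (fun n => mul_nonneg (hconc n) (by positivity))
    (coef_bound hpos hdec hconc hsum)

lemma term_bound (hconc : ∀ n, 0 ≤ α n - 2 * α (n + 1) + α (n + 2))
    {f : ℂ → ℂ} (hf : DifferentiableOn ℂ f (ball (0 : ℂ) 1)) {M : ℝ}
    (hM : ∀ z ∈ ball (0:ℂ) 1, ‖f z‖ ≤ M) (n : ℕ) {z : ℂ} (hz : z ∈ closedBall (0:ℂ) 1) :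
    ‖(((α n - 2 * α (n+1) + α (n+2)) * ((n:ℝ)+1) : ℝ) : ℂ) * cesaro f n z‖
      ≤ (α n - 2 * α (n+1) + α (n+2)) * ((n:ℝ)+1) * M := by
  have h0 : 0 ≤ (α n - 2 * α (n+1) + α (n+2)) * ((n:ℝ)+1) := mul_nonneg (hconc n) (by positivity)
  rw [norm_mul, norm_real, Real.norm_of_nonneg h0]
  exact mul_le_mul_of_nonneg_left (cesaro_bound hf hM n hz) h0

lemma seqConv_eq (hpos : ∀ n, 0 < α n) (hdec : ∀ n, α (n + 1) ≤ α n)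
    (hconc : ∀ n, 0 ≤ α n - 2 * α (n + 1) + α (n + 2))
    (hsum : Summable fun n => α n / ((n : ℝ) + 1))
    {f : ℂ → ℂ} (hf : DifferentiableOn ℂ f (ball (0 : ℂ) 1)) {M : ℝ}
    (hM : ∀ z ∈ ball (0:ℂ) 1, ‖f z‖ ≤ M) {z : ℂ} (hz : z ∈ ball (0:ℂ) 1) :
    seqConv f α z = bdry f α z := by
  have hzc := ball_subset_closedBall hz
  have hS := taylor_hasSum hf hz
  set b : ℕ → ℂ := fun n => taylorCoeff f n * z ^ n with hb
  have hanti : Antitone α := antitone_nat_of_succ_le hdec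
  have hs1 : Summable fun n => taylorCoeff f n * (α n : ℂ) * z ^ n := by
    refine Summable.of_norm_bounded (hS.summable.norm.mul_left (α 0)) fun n => ?_
    have h1 := hanti (Nat.zero_le n)
    have : taylorCoeff f n * (α n : ℂ) * z ^ n = (α n : ℂ) * b n := by simp only [hb]; ring
    rw [this, norm_mul, norm_real, Real.norm_of_nonneg (hpos n).le]
    gcongr
  have hs2 : Summable fun n : ℕ =>
      (((α n - 2 * α (n+1) + α (n+2)) * ((n:ℝ)+1) : ℝ) : ℂ) * cesaro f n z :=
    Summable.of_norm_bounded ((coef_summable hpos hdec hconc hsum).mul_right M)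
      fun n => term_bound hconc hf hM n hzc
  have hC : ∀ n : ℕ, ∑ k ∈ Finset.range (n+1), ∑ j ∈ Finset.range (k+1), b j
      = ((n:ℂ)+1) * cesaro f n z := by
    intro n
    have hn : ((n:ℂ) + 1) ≠ 0 := by exact_mod_cast Nat.succ_ne_zero n
    rw [cesaro, mul_inv_cancel_left₀ hn]
    rfl
  have ht1 := hs1.hasSum.tendsto_sum_nat
  have ht2 := hs2.hasSum.tendsto_sum_nat
  have ht3 : Filter.Tendsto (fun N => ((α N - α (N+1) : ℝ) : ℂ) *
      (∑ k ∈ Finset.range N, ∑ j ∈ Finset.range (k+1), b j)) Filter.atTop (nhds 0) := by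
    have := (n_diff_tendsto hpos hdec hconc hsum).mul_const M
    rw [zero_mul] at this
    refine squeeze_zero_norm (fun N => ?_) this
    have h0 : 0 ≤ α N - α (N+1) := by linarith [hdec N]
    rw [norm_mul, norm_real, Real.norm_of_nonneg h0]
    cases N with
    | zero => simp
    | succ n =>
      rw [hC, norm_mul]
      have hn : ‖((n:ℂ) + 1)‖ = ((n+1 : ℕ) : ℝ) := by
        have : ((n:ℂ) + 1) = ((n + 1 : ℕ) : ℂ) := by push_cast; rfl
        rw [this, Complex.norm_natCast]
      rw [hn]
      have := mul_le_mul_of_nonneg_left (cesaro_bound hf hM n hzc)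
        (mul_nonneg h0 (Nat.cast_nonneg (α := ℝ) (n+1)))
      linarith
  have ht4 : Filter.Tendsto (fun N => (α N : ℂ) * ∑ j ∈ Finset.range N, b j)
      Filter.atTop (nhds 0) := by
    have h1 : Filter.Tendsto (fun N => (α N : ℂ)) Filter.atTop (nhds 0) := by
      have := (Complex.continuous_ofReal.tendsto 0).comp (alpha_tendsto hpos hdec hsum)
      rw [Complex.ofReal_zero] at this
      exact this
    simpa using h1.mul hS.tendsto_sum_nat
  have ht5 := (ht2.add ht3).add ht4
  rw [add_zero, add_zero] at ht5
  refine tendsto_nhds_unique ht1 (ht5.congr fun N => ?_)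
  have hab := abel_twice (fun n => (α n : ℂ)) b N
  simp_rw [hC] at hab
  rw [show ∑ n ∈ Finset.range N, taylorCoeff f n * (α n : ℂ) * z ^ n
    = ∑ n ∈ Finset.range N, (α n : ℂ) * b n from
    Finset.sum_congr rfl fun n _ => by simp only [hb]; ring, hab]
  push_cast
  simp only [mul_assoc]

lemma bdry_cont (hpos : ∀ n, 0 < α n) (hdec : ∀ n, α (n + 1) ≤ α n)
    (hconc : ∀ n, 0 ≤ α n - 2 * α (n + 1) + α (n + 2))
    (hsum : Summable fun n => α n / ((n : ℝ) + 1))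
    {f : ℂ → ℂ} (hf : DifferentiableOn ℂ f (ball (0 : ℂ) 1)) {M : ℝ}
    (hM : ∀ z ∈ ball (0:ℂ) 1, ‖f z‖ ≤ M) : ContinuousOn (bdry f α) (closedBall (0:ℂ) 1) := by
  unfold bdry
  exact continuousOn_tsum (fun n => (continuous_const.mul (cesaro_continuous f n)).continuousOn)
    ((coef_summable hpos hdec hconc hsum).mul_right M)
    fun n z hz => term_bound hconc hf hM n hz

lemma toeplitz_bound (hpos : ∀ n, 0 < α n) (hdec : ∀ n, α (n + 1) ≤ α n)
    (hconc : ∀ n, 0 ≤ α n - 2 * α (n + 1) + α (n + 2))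
    (hsum : Summable fun n => α n / ((n : ℝ) + 1))
    {f : ℂ → ℂ} (hf : DifferentiableOn ℂ f (ball (0 : ℂ) 1)) {M : ℝ}
    (hM : ∀ z ∈ ball (0:ℂ) 1, ‖f z‖ ≤ M) {h hs : ℂ → ℂ}
    (hh : DifferentiableOn ℂ h (ball (0 : ℂ) 1)) {M' : ℝ}
    (hM' : ∀ z ∈ ball (0:ℂ) 1, ‖h z‖ ≤ M') (hhs : IsBoundaryFn h hs) {z : ℂ} (hz : ‖z‖ < 1) :
    ‖toeplitz (bdry f α) hs z‖ ≤ M * M' * (4 * ∑' n, α n / ((n:ℝ)+1)) := by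
  have hM0 : 0 ≤ M := (norm_nonneg _).trans (hM 0 (by simp))
  have hM0' : 0 ≤ M' := (norm_nonneg _).trans (hM' 0 (by simp))
  set d : ℕ → ℝ := fun n => (α n - 2 * α (n+1) + α (n+2)) * ((n:ℝ)+1) with hd
  have hd0 : ∀ n, 0 ≤ d n := fun n => mul_nonneg (hconc n) (by positivity)
  set A := ∑' n, α n / ((n:ℝ)+1) with hA
  set r : ℕ → ℝ := fun N => 1 - 1 / ((N:ℝ)+1) with hr
  have hr1 : ∀ N, r N < 1 := fun N => by
    simp only [hr]; linarith [show 0 < 1 / ((N:ℝ)+1) by positivity]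
  have hr0 : ∀ N, 0 ≤ r N := fun N => by
    simp only [hr, sub_nonneg]
    rw [div_le_one (by positivity)]; linarith [(Nat.cast_nonneg N : (0:ℝ) ≤ N)]
  have hrt : Filter.Tendsto r Filter.atTop (nhdsWithin 1 (Iio 1)) := by
    refine tendsto_nhdsWithin_iff.2 ⟨?_, Filter.Eventually.of_forall hr1⟩
    have := (tendsto_const_nhds (x := (1:ℝ))).sub (tendsto_one_div_add_atTop_nhds_zero_nat (𝕜 := ℝ))
    rw [sub_zero] at this
    exact this
  have hHd : ∀ N, DiffContOnCl ℂ (fun ζ => h (r N * ζ)) (ball (0:ℂ) 1) := fun N =>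
    mul_differentiableOn_ball hh (hr0 N) (hr1 N)
  have hHc : ∀ N, ContinuousOn (fun ζ => h (r N * ζ)) (sphere (0:ℂ) 1) := fun N =>
    (hHd N).continuousOn_ball.mono sphere_subset_closedBall
  have hHb : ∀ N, ∀ ζ ∈ sphere (0:ℂ) 1, ‖h (r N * ζ)‖ ≤ M' := fun N ζ hζ => by
    apply hM'
    rw [mem_sphere_zero_iff_norm] at hζ
    simpa [hζ, abs_of_nonneg (hr0 N)] using hr1 N
  have hden : ∀ ζ ∈ sphere (0:ℂ) 1, 1 - (starRingEnd ℂ) ζ * z ≠ 0 := fun ζ hζ => by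
    rw [mul_comm]
    exact one_sub_ne hz (by simp [mem_sphere_zero_iff_norm.1 hζ])
  have hcc : ∀ n, Continuous (cesaro f n) := cesaro_continuous f
  have htc : ∀ n N, ContinuousOn (fun ζ => (d n : ℂ) *
      ((starRingEnd ℂ) (cesaro f n ζ) * h (r N * ζ) / (1 - (starRingEnd ℂ) ζ * z)))
      (sphere (0:ℂ) 1) := fun n N =>
    continuousOn_const.mul (((Complex.continuous_conj.comp (hcc n)).continuousOn.mul (hHc N)).div
      (by fun_prop) hden)
  set F : ℕ → ℂ → ℂ := fun N ζ => ∑ n ∈ Finset.range N, (d n : ℂ) *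
      ((starRingEnd ℂ) (cesaro f n ζ) * h (r N * ζ) / (1 - (starRingEnd ℂ) ζ * z)) with hF
  have hFc : ∀ N, ContinuousOn (F N) (sphere (0:ℂ) 1) := fun N =>
    continuousOn_finsetSum _ fun n _ => htc n N
  have hFeq : ∀ N ζ, F N ζ = (starRingEnd ℂ) (∑ n ∈ Finset.range N, (d n : ℂ) * cesaro f n ζ)
      * h (r N * ζ) / (1 - (starRingEnd ℂ) ζ * z) := by
    intro N ζ
    simp only [hF, map_sum, Finset.sum_mul, Finset.sum_div, map_mul, conj_ofReal]
    refine Finset.sum_congr rfl fun n _ => by ring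
  have hlim : Filter.Tendsto (fun N => ∫ ζ, F N ζ ∂circleMeasure) Filter.atTop
      (nhds (toeplitz (bdry f α) hs z)) := by
    unfold toeplitz
    refine tendsto_integral_of_dominated_convergence (fun _ => (4 * A * M) * M' / (1 - ‖z‖))
      (fun N => (circle_integrable (hFc N)).aestronglyMeasurable) (integrable_const _)
      (fun N => ?_) ?_
    · filter_upwards [circle_ae] with ζ hζ
      rw [hFeq, norm_div, norm_mul, RCLike.norm_conj]
      have h1 : ‖∑ n ∈ Finset.range N, (d n : ℂ) * cesaro f n ζ‖ ≤ 4 * A * M := by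
        refine (norm_sum_le _ _).trans ?_
        refine (Finset.sum_le_sum fun n _ =>
          term_bound hconc hf hM n (sphere_subset_closedBall hζ)).trans ?_
        rw [← Finset.sum_mul]
        exact mul_le_mul_of_nonneg_right (coef_bound hpos hdec hconc hsum N) hM0
      have h2 := hHb N ζ hζ
      have h3 : 1 - ‖z‖ ≤ ‖1 - (starRingEnd ℂ) ζ * z‖ := by
        have := norm_sub_norm_le (1:ℂ) ((starRingEnd ℂ) ζ * z)
        rw [norm_one, norm_mul, RCLike.norm_conj, mem_sphere_zero_iff_norm.1 hζ, one_mul] at this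
        exact this
      have h4 : 0 < 1 - ‖z‖ := by linarith
      have h5 : 0 ≤ 4 * A * M := (norm_nonneg _).trans h1
      gcongr
    · filter_upwards [circle_ae, hhs] with ζ hζ hζh
      simp_rw [hFeq]
      have hsm : Summable fun n : ℕ => (d n : ℂ) * cesaro f n ζ :=
        Summable.of_norm_bounded ((coef_summable hpos hdec hconc hsum).mul_right M)
          fun n => term_bound hconc hf hM n (sphere_subset_closedBall hζ)
      have h1 := (Complex.continuous_conj.tendsto _).comp hsm.hasSum.tendsto_sum_nat
      exact (h1.mul (hζh.comp hrt)).div_const _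
  refine le_of_tendsto hlim.norm (Filter.Eventually.of_forall fun N => ?_)
  simp only [hF]
  rw [integral_finsetSum _ (fun n _ => circle_integrable (htc n N))]
  refine (norm_sum_le _ _).trans ?_
  have hw := weight_bound hpos hdec hconc hsum N
  refine le_trans ?_ (mul_le_mul_of_nonneg_left hw (mul_nonneg hM0 hM0'))
  rw [Finset.mul_sum]
  refine Finset.sum_le_sum fun n _ => ?_
  obtain ⟨b, hb⟩ := cesaro_poly f n
  have hk := toeplitz_poly (n := n) (b := b) hM0 hM0' hb
    (fun ζ hζ => cesaro_bound hf hM n (sphere_subset_closedBall hζ)) (hHd N) (hHb N) hz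
  rw [integral_const_mul, norm_mul, norm_real, Real.norm_of_nonneg (hd0 n)]
  refine (mul_le_mul_of_nonneg_left hk (hd0 n)).trans (le_of_eq ?_)
  simp only [hd]; ring

end main

lemma norm_le_eSup {f : ℂ → ℂ} (hfb : eSupAbs f ≠ ⊤) :
    ∀ z ∈ ball (0:ℂ) 1, ‖f z‖ ≤ (eSupAbs f).toReal := by
  intro z hz
  rw [← ENNReal.ofReal_le_iff_le_toReal hfb]
  exact le_iSup₂ (f := fun z (_ : z ∈ ball (0:ℂ) 1) => ENNReal.ofReal ‖f z‖) z hz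

/-- **Theorem 2 (boundedness on H^∞).** If `α` is a monotone decreasing, concave sequence of
positive numbers with `‖α‖ = ∑ α_n/(n+1) < ∞`, then for every `f ∈ H^∞` the Toeplitz operator
`T_{f*α}` is bounded on `H^∞`: for every `h ∈ H^∞` with boundary function `h*`,
`‖T_{f*α} h‖_{H^∞} ≤ 12 ‖f‖_{H^∞} ‖α‖ ‖h‖_{H^∞}`. -/
theorem toeplitz_conv_bounded_Hinf (α : ℕ → ℝ)
    (hpos : ∀ n, 0 < α n)
    (hdec : ∀ n, α (n + 1) ≤ α n)
    (hconc : ∀ n, 0 ≤ α n - 2 * α (n + 1) + α (n + 2))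
    (hsum : Summable fun n => α n / ((n : ℝ) + 1))
    (f : ℂ → ℂ)
    (hf : DifferentiableOn ℂ f (Metric.ball (0 : ℂ) 1))
    (hfb : eSupAbs f ≠ ⊤) :
    ∃ gs : ℂ → ℂ, IsBoundaryFn (seqConv f α) gs ∧
      ∀ h hs : ℂ → ℂ,
        DifferentiableOn ℂ h (Metric.ball (0 : ℂ) 1) →
        eSupAbs h ≠ ⊤ →
        IsBoundaryFn h hs →
        eSupAbs (toeplitz gs hs) ≤
          ENNReal.ofReal (12 * (eSupAbs f).toReal * ∑' n, α n / ((n : ℝ) + 1)) *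
            eSupAbs h := by
  have hM := norm_le_eSup hfb
  refine ⟨bdry f α, ?_, ?_⟩
  · have hc := bdry_cont hpos hdec hconc hsum hf hM
    filter_upwards [circle_ae] with ζ hζ
    have hζ' := mem_sphere_zero_iff_norm.1 hζ
    have hev : ∀ᶠ r : ℝ in nhdsWithin 1 (Set.Iio 1), (r:ℂ) * ζ ∈ ball (0:ℂ) 1 := by
      filter_upwards [Ioo_mem_nhdsLT (show (0:ℝ) < 1 by norm_num)] with r hr
      simp [hζ', abs_of_pos hr.1, hr.2]
    have ht : Filter.Tendsto (fun r : ℝ => (r:ℂ) * ζ) (nhdsWithin 1 (Set.Iio 1))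
        (nhdsWithin ζ (closedBall (0:ℂ) 1)) := by
      refine tendsto_nhdsWithin_iff.2 ⟨?_, hev.mono fun r hr => ball_subset_closedBall hr⟩
      have : Continuous fun r : ℝ => (r:ℂ) * ζ := by fun_prop
      have := (this.tendsto 1).mono_left (nhdsWithin_le_nhds (s := Set.Iio 1))
      simpa using this
    have h2 := (hc ζ (sphere_subset_closedBall hζ)).tendsto.comp ht
    refine h2.congr' ?_
    filter_upwards [hev] with r hr
    exact (seqConv_eq hpos hdec hconc hsum hf hM hr).symm
  · intro h hs hh hhb hhs
    have hM' := norm_le_eSup hhb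
    refine iSup₂_le fun z hz => ?_
    have hb := toeplitz_bound hpos hdec hconc hsum hf hM hh hM' hhs (z := z) (by simpa using hz)
    have hA : 0 ≤ ∑' n, α n / ((n : ℝ) + 1) :=
      tsum_nonneg fun n => div_nonneg (hpos n).le (by positivity)
    have h0 : 0 ≤ (eSupAbs f).toReal := ENNReal.toReal_nonneg
    have h0' : 0 ≤ (eSupAbs h).toReal := ENNReal.toReal_nonneg
    rw [← ENNReal.ofReal_toReal hhb, ← ENNReal.ofReal_mul (by positivity)]
    apply ENNReal.ofReal_le_ofReal
    refine hb.trans ?_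
    have := mul_nonneg (mul_nonneg h0 h0') hA
    nlinarith
end
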